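/- arXiv:2003.01361 — 3 statements merged into one kernel-verified Lean document; each statement's English description precedes it below -/
import Mathlib

section
/- Let X = [0,1], T(x) = 2x mod 1, and let μ denote Lebesgue measure. Let h : ℕ → ℝ satisfy h(n) → ∞ and let (Δ_m) be a sequence with Δ_m → ∞, m/Δ_m → ∞, and such that there exists σ > 0 with m^{2+σ}·2^{−Δ_m}/Δ_m ≤ 1 for all sufficiently large m. Set r_m = Δ_m · h(Δ_m)/m. Then μ(R_ea(r_m)) = 1. -/
open MeasureTheory

/-- The doubling map `x ↦ 2x (mod 1)` on `[0,1]`. -/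
noncomputable def doubling : ℝ → ℝ := fun x => Int.fract (2 * x)

/-- The set of eventually always returning points: `x` such that for all sufficiently
large `m`, the orbit segment `{T^k(x) : 1 ≤ k ≤ m}` meets `B(x, r_m)`. -/
def Rea {X : Type*} [PseudoMetricSpace X] (T : X → X) (r : ℕ → ℝ) : Set X :=
  {x | ∃ m₀ : ℕ, ∀ m, m₀ ≤ m → ∃ k, 1 ≤ k ∧ k ≤ m ∧ T^[k] x ∈ Metric.ball x (r m)}

open Finset in
/-- The `b < 2 ^ N` in whose `N`-digit binary expansion the `l`-digit block `a` does not occur. -/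
def avoiding (a l N : ℕ) : Finset ℕ :=
  (range (2 ^ N)).filter fun b => ∀ i ≤ N, i + l ≤ N → b / 2 ^ i % 2 ^ l ≠ a

open Finset in
/-- The `b < 2 ^ (2 * M + l)` in which the block `a` occurs at none of the even positions
`0, 2, …, 2 * (M - 1)`. -/
def evenAvoiding (a l M : ℕ) : Finset ℕ :=
  (range (2 ^ (2 * M + l))).filter fun b => ∀ k < M, b / 2 ^ (2 * k) % 2 ^ l ≠ a

theorem mod_two_pow_div_mod {b i l N : ℕ} (h : i + l ≤ N) :
    b % 2 ^ N / 2 ^ i % 2 ^ l = b / 2 ^ i % 2 ^ l := by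
  obtain ⟨t, rfl⟩ := Nat.exists_eq_add_of_le h
  rw [show 2 ^ (i + l + t) = 2 ^ i * 2 ^ (l + t) by ring, Nat.mod_mul_right_div_self,
    Nat.mod_mod_of_dvd _ (pow_dvd_pow 2 (Nat.le_add_right l t))]

theorem card_avoiding_le (a l N : ℕ) : (avoiding a l N).card ≤ 2 ^ N :=
  (Finset.card_filter_le _ _).trans (Finset.card_range _).le

open Finset in
theorem card_avoiding_add_le (a l N₁ N₂ : ℕ) :
    (avoiding a l (N₁ + N₂)).card ≤ (avoiding a l N₁).card * (avoiding a l N₂).card := by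
  rw [← card_product]
  refine card_le_card_of_injOn (fun b => (b % 2 ^ N₁, b / 2 ^ N₁)) ?_ ?_
  · intro b hb
    simp only [avoiding, coe_filter, mem_range, Set.mem_ofPred_eq] at hb
    obtain ⟨hb, hb'⟩ := hb
    simp only [avoiding, coe_product, Set.mem_prod, coe_filter, mem_range, Set.mem_ofPred_eq]
    refine ⟨⟨Nat.mod_lt _ (by positivity), fun i hi' hi => ?_⟩, ?_, fun i hi' hi => ?_⟩
    · rw [mod_two_pow_div_mod hi]
      exact hb' i (by omega) (by omega)
    · rw [pow_add] at hb
      exact Nat.div_lt_of_lt_mul hb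
    · rw [Nat.div_div_eq_div_mul, ← pow_add]
      exact hb' _ (by omega) (by omega)
  · intro b _ c _ hbc
    simp only [Prod.mk.injEq] at hbc
    rw [← Nat.mod_add_div b (2 ^ N₁), ← Nat.mod_add_div c (2 ^ N₁), hbc.1, hbc.2]

open Finset in
theorem card_two_occurrences_le (a l d n : ℕ) :
    ((range (2 ^ (n + d + l))).filter
      fun b => b % 2 ^ l = a ∧ b / 2 ^ d % 2 ^ l = a).card ≤ 2 ^ (d - l) * 2 ^ n := by
  rw [← card_range (2 ^ (d - l)), ← card_range (2 ^ n), ← card_product]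
  refine card_le_card_of_injOn (fun b => (b % 2 ^ d / 2 ^ l, b / 2 ^ (d + l))) ?_ ?_
  · intro b hb
    simp only [coe_filter, mem_range, Set.mem_ofPred_eq] at hb
    simp only [coe_product, Set.mem_prod, coe_range, Set.mem_Iio]
    constructor
    · apply Nat.div_lt_of_lt_mul
      rw [← pow_add]
      exact (Nat.mod_lt _ (by positivity)).trans_le
        (Nat.pow_le_pow_right two_pos (by omega))
    · apply Nat.div_lt_of_lt_mul
      rw [← pow_add, show d + l + n = n + d + l by ring]
      exact hb.1
  · intro b hb c hc hbc
    simp only [coe_filter, mem_range, Set.mem_ofPred_eq] at hb hc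
    simp only [Prod.mk.injEq] at hbc
    have low : b % 2 ^ d = c % 2 ^ d := by
      rcases le_total d l with hdl | hdl
      · rw [← Nat.mod_mod_of_dvd b (pow_dvd_pow 2 hdl), ← Nat.mod_mod_of_dvd c (pow_dvd_pow 2 hdl),
          hb.2.1, hc.2.1]
      · rw [← Nat.mod_add_div (b % 2 ^ d) (2 ^ l), ← Nat.mod_add_div (c % 2 ^ d) (2 ^ l), hbc.1,
          Nat.mod_mod_of_dvd b (pow_dvd_pow 2 hdl), Nat.mod_mod_of_dvd c (pow_dvd_pow 2 hdl),
          hb.2.1, hc.2.1]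
    rw [← Nat.mod_add_div b (2 ^ (d + l)), ← Nat.mod_add_div c (2 ^ (d + l)), hbc.2, pow_add,
      Nat.mod_mul, Nat.mod_mul, low, hb.2.2, hc.2.2]

open Finset in
theorem card_evenAvoiding_succ_le {a l : ℕ} (ha : a < 2 ^ l) (M : ℕ) :
    (evenAvoiding a l (M + 1)).card + 2 ^ (2 * (M + 1)) ≤ 4 * (evenAvoiding a l M).card +
      ∑ k ∈ range M, 2 ^ (2 * (k + 1) - l) * 2 ^ (2 * (M - k)) := by
  set n := 2 * (M + 1) + l with hn
  set G := (range (2 ^ n)).filter fun b => b / 4 ∈ evenAvoiding a l M with hG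
  set B := (range (2 ^ n)).filter fun b => b % 2 ^ l = a with hB
  set P : ℕ → Finset ℕ := fun k => (range (2 ^ n)).filter
    fun b => b % 2 ^ l = a ∧ b / 2 ^ (2 * (k + 1)) % 2 ^ l = a with hP
  have shift (b k : ℕ) : b / 4 / 2 ^ (2 * k) = b / 2 ^ (2 * (k + 1)) := by
    rw [Nat.div_div_eq_div_mul, show 2 ^ (2 * (k + 1)) = 4 * 2 ^ (2 * k) by
      rw [mul_add, pow_add]; ring]
  have size (b : ℕ) (hb : b < 2 ^ n) : b / 4 < 2 ^ (2 * M + l) := by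
    apply Nat.div_lt_of_lt_mul
    rw [hn, show 2 * (M + 1) + l = 2 + (2 * M + l) by ring, pow_add] at hb
    simpa using hb
  have G_card : G.card ≤ 4 * (evenAvoiding a l M).card := by
    rw [← card_range 4, ← card_product]
    refine card_le_card_of_injOn (fun b => (b % 4, b / 4)) ?_ ?_
    · intro b hb
      simp only [hG, coe_filter, Set.mem_ofPred_eq] at hb
      simpa [Nat.mod_lt] using hb.2
    · intro b _ c _ hbc
      simp only [Prod.mk.injEq] at hbc
      omega
  have B_card : 2 ^ (2 * (M + 1)) ≤ B.card := by
    rw [← card_range (2 ^ (2 * (M + 1)))]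
    refine card_le_card_of_injOn (fun t => 2 ^ l * t + a) ?_ ?_
    · intro t ht
      simp only [coe_range, Set.mem_Iio] at ht
      simp only [hB, coe_filter, mem_range, Set.mem_ofPred_eq]
      refine ⟨?_, ?_⟩
      · calc 2 ^ l * t + a < 2 ^ l * (t + 1) := by rw [mul_add]; omega
          _ ≤ 2 ^ l * 2 ^ (2 * (M + 1)) := Nat.mul_le_mul_left _ ht
          _ = 2 ^ n := by rw [hn, pow_add]; ring
      · rw [Nat.mul_add_mod, Nat.mod_eq_of_lt ha]
    · intro t _ u _ htu
      simpa using htu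
  have P_card : ∀ k ∈ range M, (P k).card ≤ 2 ^ (2 * (k + 1) - l) * 2 ^ (2 * (M - k)) := by
    intro k hk
    have hk := mem_range.1 hk
    have := card_two_occurrences_le a l (2 * (k + 1)) (2 * (M - k))
    rwa [show 2 * (M - k) + 2 * (k + 1) + l = n by omega] at this
  have B_sub : B ⊆ (B ∩ G) ∪ (range M).biUnion P := by
    intro b hb
    have hb' := hb
    simp only [hB, mem_filter, mem_range] at hb'
    by_cases hbG : b ∈ G
    · exact mem_union_left _ (mem_inter.2 ⟨hb, hbG⟩)
    · refine mem_union_right _ ?_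
      simp only [hG, evenAvoiding, mem_filter, mem_range, not_and, not_forall, ne_eq,
        not_not] at hbG
      obtain ⟨k, hk, hk'⟩ := hbG hb'.1 (size b hb'.1)
      rw [shift] at hk'
      simp only [mem_biUnion, mem_range, hP, mem_filter]
      exact ⟨k, hk, hb'.1, hb'.2, hk'⟩
  have V_sub : evenAvoiding a l (M + 1) ⊆ G \ B := by
    intro b hb
    simp only [evenAvoiding, mem_filter, mem_range] at hb
    simp only [hG, hB, evenAvoiding, mem_sdiff, mem_filter, mem_range, not_and]
    refine ⟨⟨hb.1, size b hb.1, fun k hk => ?_⟩, fun _ => ?_⟩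
    · rw [shift]
      exact hb.2 (k + 1) (by omega)
    · simpa using hb.2 0 (by omega)
  have h₁ := card_le_card V_sub
  have h₂ := card_sdiff_add_card_inter G B
  have h₃ := (card_le_card B_sub).trans (card_union_le _ _)
  have h₄ := card_biUnion_le.trans (sum_le_sum P_card)
  rw [inter_comm] at h₂
  omega

open Finset in
theorem card_evenAvoiding_div_le {a l : ℕ} (ha : a < 2 ^ l) (M : ℕ) (hM : 4 * M ≤ 2 ^ l) :
    ((evenAvoiding a l M).card : ℝ) / 2 ^ (2 * M + l) ≤ 1 - 5 / 12 * M / 2 ^ l := by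
  induction M with
  | zero =>
    have : ((evenAvoiding a l 0).card : ℝ) ≤ 2 ^ (2 * 0 + l) := by
      exact_mod_cast (card_filter_le _ _).trans (card_range _).le
    simpa using div_le_one_of_le₀ this (by positivity)
  | succ M ih =>
    have ih := ih (by omega)
    have key : ((evenAvoiding a l (M + 1)).card : ℝ) + 2 ^ (2 * (M + 1)) ≤
        4 * (evenAvoiding a l M).card +
          ∑ k ∈ range M, 2 ^ (2 * (k + 1) - l) * 2 ^ (2 * (M - k)) := by
      exact_mod_cast card_evenAvoiding_succ_le ha M
    have geom : ∀ j : ℕ, ∑ k ∈ range j, (1 / 4 : ℝ) ^ (k + 1) = (1 - (1 / 4) ^ j) / 3 := by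
      intro j
      induction j with
      | zero => simp
      | succ j ihj => rw [sum_range_succ, ihj]; ring
    have overlap : ∑ k ∈ range M, (2 : ℝ) ^ (2 * (k + 1) - l) * 2 ^ (2 * (M - k)) ≤
        2 ^ (2 * (M + 1)) * (7 / 12) := by
      have term : ∀ k ∈ range M, (2 : ℝ) ^ (2 * (k + 1) - l) * 2 ^ (2 * (M - k)) ≤
          2 ^ (2 * (M + 1)) * ((1 / 4) ^ (k + 1) + 1 / 2 ^ l) := by
        intro k hk
        have hk := mem_range.1 hk
        have e : (2 : ℝ) ^ (2 * (M + 1)) = 2 ^ (2 * (M - k)) * 2 ^ (2 * (k + 1)) := by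
          rw [← pow_add]; congr 1; omega
        have e' : (2 : ℝ) ^ (2 * (k + 1)) * (1 / 4) ^ (k + 1) = 1 := by
          rw [pow_mul, ← mul_pow]; norm_num
        rw [e, mul_assoc, mul_comm ((2 : ℝ) ^ (2 * (k + 1) - l))]
        refine mul_le_mul_of_nonneg_left ?_ (by positivity)
        rw [mul_add ((2 : ℝ) ^ (2 * (k + 1))), e']
        rcases le_total (2 * (k + 1)) l with hl | hl
        · rw [Nat.sub_eq_zero_of_le hl, pow_zero]
          have : (0 : ℝ) ≤ 2 ^ (2 * (k + 1)) * (1 / 2 ^ l) := by positivity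
          linarith
        · have : (2 : ℝ) ^ (2 * (k + 1)) * (1 / 2 ^ l) = 2 ^ (2 * (k + 1) - l) := by
            rw [pow_sub₀ _ two_ne_zero hl, one_div]
          linarith
      refine (sum_le_sum term).trans ?_
      rw [← mul_sum]
      refine mul_le_mul_of_nonneg_left ?_ (by positivity)
      rw [sum_add_distrib, geom, sum_const, card_range, nsmul_eq_mul]
      have h₁ : (M : ℝ) * (1 / 2 ^ l) ≤ 1 / 4 := by
        rw [mul_one_div, div_le_iff₀ (by positivity)]
        have : (4 * (M + 1) : ℝ) ≤ 2 ^ l := by exact_mod_cast hM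
        linarith
      have h₂ : (0 : ℝ) ≤ (1 / 4) ^ M := by positivity
      linarith
    have e₁ : (2 : ℝ) ^ (2 * (M + 1) + l) = 4 * 2 ^ (2 * M + l) := by
      rw [show 2 * (M + 1) + l = 2 + (2 * M + l) by ring, pow_add]; norm_num
    have e₂ : (2 : ℝ) ^ (2 * (M + 1)) = 4 * 2 ^ (2 * M + l) / 2 ^ l := by
      rw [← e₁, pow_add]; field_simp
    rw [div_le_iff₀ (by positivity)] at ih ⊢
    calc ((evenAvoiding a l (M + 1)).card : ℝ)
        ≤ 4 * (evenAvoiding a l M).card - 5 / 12 * 2 ^ (2 * (M + 1)) := by linarith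
      _ ≤ 4 * ((1 - 5 / 12 * M / 2 ^ l) * 2 ^ (2 * M + l)) - 5 / 12 * 2 ^ (2 * (M + 1)) := by
          linarith
      _ = _ := by rw [e₁, e₂]; push_cast; ring

theorem card_avoiding_two_pow_le {a l : ℕ} (hl : 2 ≤ l) (ha : a < 2 ^ l) :
    ((avoiding a l (2 ^ l)).card : ℝ) ≤ 9 / 10 * 2 ^ 2 ^ l := by
  obtain ⟨t, rfl⟩ := Nat.exists_eq_add_of_le hl
  have h4 : 2 ^ (2 + t) = 4 * 2 ^ t := by rw [pow_add]; norm_num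
  have ht : t < 2 ^ t := Nat.lt_two_pow_self
  obtain ⟨u, hu⟩ : ∃ u, 2 ^ (2 + t) = (2 * 2 ^ t + (2 + t)) + u :=
    Nat.exists_eq_add_of_le (by
      rw [h4]
      rcases t with _ | t
      · norm_num
      · rw [pow_succ] at ht ⊢
        have : t < 2 ^ t := Nat.lt_two_pow_self
        omega)
  have sub : avoiding a (2 + t) (2 * 2 ^ t + (2 + t)) ⊆ evenAvoiding a (2 + t) (2 ^ t) := by
    intro b hb
    simp only [avoiding, evenAvoiding, Finset.mem_filter] at hb ⊢
    exact ⟨hb.1, fun k hk => hb.2 _ (by omega) (by omega)⟩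
  have h₁ := card_evenAvoiding_div_le ha (2 ^ t) h4.ge
  have h₂ : ((avoiding a (2 + t) (2 * 2 ^ t + (2 + t))).card : ℝ) ≤
      (evenAvoiding a (2 + t) (2 ^ t)).card := by exact_mod_cast Finset.card_le_card sub
  have h₃ : (5 / 12 * ((2 ^ t : ℕ) : ℝ) / 2 ^ (2 + t)) = 5 / 48 := by
    rw [pow_add]; push_cast; field_simp; norm_num
  rw [h₃, div_le_iff₀ (by positivity)] at h₁
  have h₄ : ((avoiding a (2 + t) (2 * 2 ^ t + (2 + t))).card : ℝ) ≤
      9 / 10 * 2 ^ (2 * 2 ^ t + (2 + t)) := by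
    have : (0 : ℝ) < 2 ^ (2 * 2 ^ t + (2 + t)) := by positivity
    linarith
  have h₅ : ((avoiding a (2 + t) (2 * 2 ^ t + (2 + t) + u)).card : ℝ) ≤
      (avoiding a (2 + t) (2 * 2 ^ t + (2 + t))).card * 2 ^ u := by
    exact_mod_cast (card_avoiding_add_le _ _ _ _).trans
      (Nat.mul_le_mul_left _ (card_avoiding_le _ _ _))
  rw [hu, pow_add 2 _ u, ← mul_assoc]
  exact h₅.trans (mul_le_mul_of_nonneg_right h₄ (by positivity))

theorem card_avoiding_mul_two_pow_le {a l : ℕ} (hl : 2 ≤ l) (ha : a < 2 ^ l) (s : ℕ) :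
    ((avoiding a l (s * 2 ^ l)).card : ℝ) ≤ (9 / 10) ^ s * 2 ^ (s * 2 ^ l) := by
  induction s with
  | zero => exact_mod_cast (by simpa using card_avoiding_le a l 0)
  | succ s ih =>
    have h₁ : ((avoiding a l (s * 2 ^ l + 2 ^ l)).card : ℝ) ≤
        (avoiding a l (s * 2 ^ l)).card * (avoiding a l (2 ^ l)).card := by
      exact_mod_cast card_avoiding_add_le _ _ _ _
    rw [add_mul, one_mul]
    calc _ ≤ _ := h₁
      _ ≤ ((9 / 10) ^ s * 2 ^ (s * 2 ^ l)) * (9 / 10 * 2 ^ 2 ^ l) :=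
        mul_le_mul ih (card_avoiding_two_pow_le hl ha) (by positivity) (by positivity)
      _ = _ := by rw [pow_succ, pow_add]; ring

theorem doubling_iterate (k : ℕ) {x : ℝ} (hx : x ∈ Set.Ico (0 : ℝ) 1) :
    doubling^[k] x = Int.fract (2 ^ k * x) := by
  induction k with
  | zero => simpa using (Int.fract_eq_self.2 hx).symm
  | succ k ih =>
    rw [Function.iterate_succ_apply', ih]
    unfold doubling
    rw [Int.fract_eq_fract]
    refine ⟨-(2 * ⌊(2 : ℝ) ^ k * x⌋), ?_⟩
    have := Int.self_sub_floor ((2 : ℝ) ^ k * x)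
    rw [← this]
    push_cast
    ring

theorem floor_two_pow_mul_fract (l : ℕ) {y : ℝ} (hy : 0 ≤ y) :
    ⌊2 ^ l * Int.fract y⌋₊ = ⌊2 ^ l * y⌋₊ % 2 ^ l := by
  have h₁ : (2 : ℝ) ^ l * y = 2 ^ l * Int.fract y + ((2 ^ l * ⌊y⌋₊ : ℕ) : ℝ) := by
    have : (⌊y⌋₊ : ℝ) = ⌊y⌋ := natCast_floor_eq_intCast_floor hy
    push_cast
    rw [this, ← mul_add, Int.fract_add_floor]
  have h₂ : ⌊2 ^ l * Int.fract y⌋₊ < 2 ^ l := by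
    rw [Nat.floor_lt (mul_nonneg (by positivity) (Int.fract_nonneg y))]
    push_cast
    have := Int.fract_lt_one y
    have : (0 : ℝ) < 2 ^ l := by positivity
    nlinarith
  rw [h₁, Nat.floor_add_natCast (mul_nonneg (by positivity) (Int.fract_nonneg y)),
    Nat.add_mul_mod_self_left, Nat.mod_eq_of_lt h₂]

theorem floor_two_pow_mul_div (i j : ℕ) (x : ℝ) :
    ⌊2 ^ (i + j) * x⌋₊ / 2 ^ j = ⌊2 ^ i * x⌋₊ := by
  rw [← Nat.floor_div_natCast]
  congr 1
  push_cast
  rw [pow_add]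
  field_simp

theorem abs_sub_lt_of_floor_eq (l : ℕ) {x y : ℝ} (hx : 0 ≤ x) (hy : 0 ≤ y)
    (h : ⌊2 ^ l * x⌋₊ = ⌊2 ^ l * y⌋₊) : |x - y| < (1 / 2) ^ l := by
  have hp : (0 : ℝ) < 2 ^ l := by positivity
  have h₁ := Nat.floor_le (mul_nonneg hp.le hx)
  have h₂ := Nat.lt_floor_add_one (2 ^ l * x)
  have h₃ := Nat.floor_le (mul_nonneg hp.le hy)
  have h₄ := Nat.lt_floor_add_one (2 ^ l * y)
  rw [h] at h₁ h₂
  rw [one_div_pow, lt_div_iff₀ hp]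
  nth_rw 1 [← abs_of_pos hp]
  rw [← abs_mul, abs_lt]
  constructor <;> linarith

open Finset in
/-- The numbers below `2 ^ (l + N)` whose leading `l` digits do not occur among their last `N`
digits. -/
def nonreturning (l N : ℕ) : Finset ℕ :=
  (range (2 ^ (l + N))).filter fun c => c % 2 ^ N ∈ avoiding (c / 2 ^ N) l N

open Finset in
theorem card_nonreturning_le {l : ℕ} (hl : 2 ≤ l) (s : ℕ) :
    ((nonreturning l (s * 2 ^ l)).card : ℝ) ≤ (9 / 10) ^ s * 2 ^ (l + s * 2 ^ l) := by
  set N := s * 2 ^ l with hN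
  have h₁ : (nonreturning l N).card ≤ ((range (2 ^ l)).sigma fun a => avoiding a l N).card := by
    refine card_le_card_of_injOn (fun c => ⟨c / 2 ^ N, c % 2 ^ N⟩) ?_ ?_
    · intro c hc
      simp only [nonreturning, coe_filter, mem_range, Set.mem_ofPred_eq] at hc
      simp only [mem_coe, mem_sigma, mem_range]
      refine ⟨Nat.div_lt_of_lt_mul ?_, hc.2⟩
      rw [← pow_add, add_comm]
      exact hc.1
    · intro b _ c _ hbc
      simp only [Sigma.mk.injEq, heq_eq_eq] at hbc
      rw [← Nat.mod_add_div b (2 ^ N), ← Nat.mod_add_div c (2 ^ N), hbc.1, hbc.2]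
  rw [card_sigma] at h₁
  calc ((nonreturning l N).card : ℝ) ≤ ∑ a ∈ range (2 ^ l), ((avoiding a l N).card : ℝ) := by
        exact_mod_cast h₁
    _ ≤ ∑ a ∈ range (2 ^ l), (9 / 10 : ℝ) ^ s * 2 ^ N :=
        sum_le_sum fun a ha => card_avoiding_mul_two_pow_le hl (mem_range.1 ha) s
    _ = _ := by
        rw [sum_const, card_range, nsmul_eq_mul, pow_add]
        push_cast
        ring

theorem floor_mem_nonreturning {l N : ℕ} (hl : 1 ≤ l) {x : ℝ} (hx : x ∈ Set.Ico (0 : ℝ) 1)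
    (hret : ∀ k, 1 ≤ k → k ≤ N → (1 / 2) ^ l ≤ |doubling^[k] x - x|) :
    ⌊2 ^ (l + N) * x⌋₊ ∈ nonreturning l N := by
  have hp : (0 : ℝ) < 2 ^ (l + N) := by positivity
  simp only [nonreturning, avoiding, Finset.mem_filter, Finset.mem_range]
  refine ⟨?_, Nat.mod_lt _ (by positivity), fun i hiN hi heq => ?_⟩
  · rw [Nat.floor_lt (mul_nonneg hp.le hx.1)]
    push_cast
    nlinarith [hx.2]
  · rw [mod_two_pow_div_mod hi, floor_two_pow_mul_div] at heq
    obtain ⟨k, hk⟩ := Nat.exists_eq_add_of_le hiN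
    have hk' : l + N = (l + k) + i := by omega
    rw [hk', floor_two_pow_mul_div, pow_add, mul_assoc,
      ← floor_two_pow_mul_fract l (mul_nonneg (by positivity) hx.1), ← doubling_iterate k hx] at heq
    have hT : 0 ≤ doubling^[k] x := by rw [doubling_iterate k hx]; exact Int.fract_nonneg _
    exact (abs_sub_lt_of_floor_eq l hT hx.1 heq).not_ge (hret k (by omega) (by omega))

theorem volume_setOf_no_return_le {l : ℕ} (hl : 2 ≤ l) (s : ℕ) :
    (volume.restrict (Set.Ico (0 : ℝ) 1))
      {x | ∀ k, 1 ≤ k → k ≤ s * 2 ^ l → (1 / 2) ^ l ≤ |doubling^[k] x - x|} ≤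
        ENNReal.ofReal ((9 / 10) ^ s) := by
  set N := s * 2 ^ l with hN
  have hp : (0 : ℝ) < 2 ^ (l + N) := by positivity
  rw [Measure.restrict_apply' measurableSet_Ico]
  have sub : {x | ∀ k, 1 ≤ k → k ≤ N → (1 / 2) ^ l ≤ |doubling^[k] x - x|} ∩ Set.Ico (0 : ℝ) 1 ⊆
      ⋃ c ∈ nonreturning l N,
        Set.Ico ((c : ℝ) / 2 ^ (l + N)) (((c : ℝ) + 1) / 2 ^ (l + N)) := by
    rintro x ⟨hret, hx⟩
    refine Set.mem_biUnion (floor_mem_nonreturning (by omega) hx hret) ⟨?_, ?_⟩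
    · rw [div_le_iff₀ hp, mul_comm x]
      exact Nat.floor_le (mul_nonneg hp.le hx.1)
    · rw [lt_div_iff₀ hp, mul_comm x]
      exact Nat.lt_floor_add_one _
  refine (measure_mono sub).trans ((measure_biUnion_finset_le _ _).trans ?_)
  have hlen (c : ℕ) : ((c : ℝ) + 1) / 2 ^ (l + N) - c / 2 ^ (l + N) = 1 / 2 ^ (l + N) := by ring
  simp only [Real.volume_Ico, hlen, Finset.sum_const]
  rw [nsmul_eq_mul, ← ENNReal.ofReal_natCast, ← ENNReal.ofReal_mul (by positivity)]
  apply ENNReal.ofReal_le_ofReal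
  rw [mul_one_div, div_le_iff₀ hp]
  exact card_nonreturning_le hl s

theorem ae_eventually_return : ∀ᵐ x ∂(volume.restrict (Set.Ico (0 : ℝ) 1)),
    ∀ᶠ l in Filter.atTop, ∃ k, 1 ≤ k ∧ k ≤ l * 2 ^ l ∧ |doubling^[k] x - x| < (1 / 2) ^ l := by
  set E : ℕ → Set ℝ := fun l =>
    {x | ∀ k, 1 ≤ k → k ≤ (l + 2) * 2 ^ (l + 2) → (1 / 2) ^ (l + 2) ≤ |doubling^[k] x - x|}
  have hE : ∑' l, (volume.restrict (Set.Ico (0 : ℝ) 1)) (E l) ≠ ⊤ := by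
    have hsum : Summable fun l : ℕ => (9 / 10 : ℝ) ^ (l + 2) :=
      (summable_nat_add_iff 2).2 (summable_geometric_of_lt_one (by norm_num) (by norm_num))
    exact ne_top_of_le_ne_top hsum.tsum_ofReal_ne_top
      (ENNReal.tsum_le_tsum fun l => volume_setOf_no_return_le (by omega) (l + 2))
  filter_upwards [ae_eventually_notMem hE] with x hx
  obtain ⟨l₀, hl₀⟩ := Filter.eventually_atTop.1 hx
  refine Filter.eventually_atTop.2 ⟨l₀ + 2, fun l hl => ?_⟩
  obtain ⟨j, rfl⟩ := Nat.exists_eq_add_of_le' (show 2 ≤ l by omega)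
  have := hl₀ j (by omega)
  simpa only [E, Set.mem_ofPred_eq, not_forall, not_le, exists_prop] using this

theorem exists_block_length (m : ℕ) :
    ∃ l, l * 2 ^ l ≤ m ∧ m < (l + 1) * 2 ^ (l + 1) := by
  have hex : ∃ l, m < (l + 1) * 2 ^ (l + 1) := by
    refine ⟨m, Nat.lt_two_pow_self.trans_le ?_⟩
    exact (Nat.pow_le_pow_right two_pos m.le_succ).trans (Nat.le_mul_of_pos_left _ m.succ_pos)
  classical
  refine ⟨Nat.find hex, ?_, Nat.find_spec hex⟩
  rcases hl : Nat.find hex with _ | l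
  · simp
  · exact not_lt.1 (Nat.find_min hex (by omega))

theorem stmt7 (h : ℕ → ℝ) (hh : Filter.Tendsto h Filter.atTop Filter.atTop)
    (Δ : ℕ → ℕ) (hΔ : Filter.Tendsto Δ Filter.atTop Filter.atTop)
    (hmΔ : Filter.Tendsto (fun m : ℕ => (m : ℝ) / (Δ m : ℝ)) Filter.atTop Filter.atTop)
    (σ : ℝ) (hσ : 0 < σ)
    (hbound : ∀ᶠ m : ℕ in Filter.atTop,
      (m : ℝ) ^ (2 + σ) * 2 ^ (-(Δ m : ℝ)) / (Δ m : ℝ) ≤ 1)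
    (r : ℕ → ℝ) (hr : ∀ m : ℕ, r m = (Δ m : ℝ) * h (Δ m) / m) :
    (volume.restrict (Set.Icc (0:ℝ) 1)) (Rea doubling r) = 1 := by
  rw [Measure.restrict_congr_set Ico_ae_eq_Icc.symm]
  have hae : ∀ᵐ x ∂(volume.restrict (Set.Ico (0 : ℝ) 1)), x ∈ Rea doubling r := by
    have hlog : ∀ᶠ m in Filter.atTop, m ≤ 2 ^ Δ m := by
      filter_upwards [hbound, hΔ.eventually_ge_atTop 1, Filter.eventually_ge_atTop 1]
        with m hm hΔm hm1
      have hm1' : (1 : ℝ) ≤ m := by exact_mod_cast hm1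
      have hΔ' : (0 : ℝ) < Δ m := by exact_mod_cast hΔm
      rw [div_le_one hΔ', Real.rpow_neg two_pos.le, Real.rpow_natCast, ← div_eq_mul_inv,
        div_le_iff₀ (by positivity)] at hm
      have h₁ : (m : ℝ) ^ 2 ≤ (m : ℝ) ^ (2 + σ) := by
        rw [← Real.rpow_natCast]
        exact Real.rpow_le_rpow_of_exponent_le hm1' (by push_cast; linarith)
      have h₂ : (Δ m : ℝ) ≤ 2 ^ Δ m := by exact_mod_cast Nat.lt_two_pow_self.le
      have h₃ : (m : ℝ) ^ 2 ≤ (2 ^ Δ m) ^ 2 := by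
        calc (m : ℝ) ^ 2 ≤ Δ m * 2 ^ Δ m := h₁.trans hm
          _ ≤ 2 ^ Δ m * 2 ^ Δ m := by gcongr
          _ = _ := by ring
      exact_mod_cast (pow_le_pow_iff_left₀ (by positivity) (by positivity) two_ne_zero).1 h₃
    filter_upwards [ae_eventually_return] with x hx
    obtain ⟨l₀, hl₀⟩ := Filter.eventually_atTop.1 hx
    refine Filter.eventually_atTop.1 ?_
    filter_upwards [hlog, (hh.comp hΔ).eventually_ge_atTop 4,
      Filter.eventually_ge_atTop ((l₀ + 2) * 2 ^ (l₀ + 2))] with m hm hhm hml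
    obtain ⟨l, hlm, hml'⟩ := exists_block_length m
    have hl : l₀ + 1 ≤ l := by
      by_contra! hlt
      have : (l + 1) * 2 ^ (l + 1) ≤ (l₀ + 2) * 2 ^ (l₀ + 2) :=
        Nat.mul_le_mul (by omega) (Nat.pow_le_pow_right two_pos (by omega))
      omega
    obtain ⟨k, hk1, hk, hdist⟩ := hl₀ l (by omega)
    refine ⟨k, hk1, hk.trans hlm, ?_⟩
    rw [Metric.mem_ball, Real.dist_eq, hr]
    refine hdist.trans_le ?_
    have hlΔ : l ≤ Δ m := by
      have : 2 ^ l ≤ 2 ^ Δ m :=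
        ((Nat.le_mul_of_pos_left _ (by omega)).trans hlm).trans hm
      exact (Nat.pow_le_pow_iff_right (by norm_num)).1 this
    have hm0 : (0 : ℝ) < m := by
      exact_mod_cast (show 0 < (l₀ + 2) * 2 ^ (l₀ + 2) by positivity).trans_le hml
    have hlΔ' : (l : ℝ) ≤ Δ m := by exact_mod_cast hlΔ
    have hl1 : (1 : ℝ) ≤ l := by exact_mod_cast (by omega : 1 ≤ l)
    have hhm' : 4 ≤ h (Δ m) := hhm
    rw [one_div_pow, div_le_div_iff₀ (by positivity) hm0, one_mul]
    calc (m : ℝ) ≤ (l + 1) * 2 ^ (l + 1) := by exact_mod_cast hml'.le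
      _ = (2 * (l + 1)) * 2 ^ l := by ring
      _ ≤ (Δ m * h (Δ m)) * 2 ^ l := by
        refine mul_le_mul_of_nonneg_right ?_ (by positivity)
        nlinarith
  have huniv : Rea doubling r =ᵐ[volume.restrict (Set.Ico (0 : ℝ) 1)] Set.univ :=
    Filter.eventuallyEq_univ.2 hae
  rw [measure_congr huniv]
  simp
end

section
/- Let T : [0,1] → [0,1] preserve a Borel probability measure μ, and assume the system has summable decay of correlations p(n) for L¹ against BV. Suppose F : [0,1]² → ℝ is the indicator function of an open or closed convex subset of [0,1]². Then for every n ∈ ℕ, |∫ F(T^n(x), x) dμ(x) − ∬ F(x,y) dμ(x) dμ(y)| ≤ 3 p(n). -/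
open MeasureTheory

/-- The BV norm of `g` on `[0,1]`: total variation plus sup norm. -/
noncomputable def BVNorm (g : ℝ → ℝ) : ℝ :=
  (eVariationOn g (Set.Icc 0 1)).toReal + sSup ((fun x => |g x|) '' Set.Icc 0 1)

/-- The system `(X, T, μ)` on `X = [0,1]` has decay of correlations `p` for `L¹`
against `BV`. -/
def DecayL1BV (T : ℝ → ℝ) (μ : Measure ℝ) (p : ℕ → ℝ) : Prop :=
  ∀ (n : ℕ) (f g : ℝ → ℝ), Integrable f μ → BoundedVariationOn g (Set.Icc 0 1) →
    |(∫ x, f (T^[n] x) * g x ∂μ) - (∫ x, f x ∂μ) * ∫ x, g x ∂μ| ≤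
      (∫ x, |f x| ∂μ) * BVNorm g * p n

open Set Filter Topology

lemma eVariationOn_sub_le {α E : Type*} [LinearOrder α] [SeminormedAddCommGroup E]
    (f g : α → E) (s : Set α) :
    eVariationOn (f - g) s ≤ eVariationOn f s + eVariationOn g s := by
  refine iSup_le fun ⟨k, u, hu, hus⟩ => ?_
  refine le_trans ?_ (add_le_add (eVariationOn.sum_le (f := f) (n := k) hu hus)
    (eVariationOn.sum_le (f := g) (n := k) hu hus))
  rw [← Finset.sum_add_distrib]
  refine Finset.sum_le_sum fun i _ => ?_
  rw [Pi.sub_apply, Pi.sub_apply, edist_eq_enorm_sub, edist_eq_enorm_sub, edist_eq_enorm_sub,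
    sub_sub_sub_comm]
  exact enorm_sub_le

lemma IsUpperSet.eVariationOn_indicator_le {s : Set ℝ} (hs : IsUpperSet s) :
    eVariationOn (s.indicator (1 : ℝ → ℝ)) (Icc 0 1) ≤ 1 := by
  have hmono : Monotone (s.indicator (1 : ℝ → ℝ)) := fun x y hxy => by
    by_cases hx : x ∈ s
    · simp [hx, hs hxy hx]
    · rw [indicator_of_notMem hx]
      exact indicator_nonneg (fun _ _ => zero_le_one) y
  have h := (hmono.monotoneOn univ).eVariationOn_eq (mem_univ 0) (mem_univ 1)
  rw [univ_inter] at h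
  rw [h, ENNReal.ofReal_le_one]
  have h0 : 0 ≤ s.indicator (1 : ℝ → ℝ) 0 := indicator_nonneg (fun _ _ => zero_le_one) _
  have h1 : s.indicator (1 : ℝ → ℝ) 1 ≤ 1 := indicator_le_self' (fun _ _ => zero_le_one) _
  linarith

lemma Set.OrdConnected.eVariationOn_indicator_le {s : Set ℝ} (hs : s.OrdConnected) :
    eVariationOn (s.indicator (1 : ℝ → ℝ)) (Icc 0 1) ≤ 2 := by
  have hupper : IsUpperSet ((upperClosure s : Set ℝ) \ s) := by
    rintro x y hxy ⟨⟨a, ha, hax⟩, hxs⟩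
    exact ⟨⟨a, ha, hax.trans hxy⟩, fun hys => hxs (hs.out ha hys ⟨hax, hxy⟩)⟩
  have heq : s.indicator (1 : ℝ → ℝ) = (upperClosure s : Set ℝ).indicator 1 -
      ((upperClosure s : Set ℝ) \ s).indicator 1 := by
    ext x
    by_cases hx : x ∈ s
    · simp [hx, show x ∈ (upperClosure s : Set ℝ) from subset_upperClosure hx]
    · by_cases hxu : x ∈ (upperClosure s : Set ℝ) <;> simp only [Pi.sub_apply, indicator] <;>
        simp [hx, hxu]
  rw [heq, ← one_add_one_eq_two]
  exact (eVariationOn_sub_le _ _ _).trans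
    (add_le_add (upperClosure s).upper.eVariationOn_indicator_le
      hupper.eVariationOn_indicator_le)

lemma Set.OrdConnected.BVNorm_indicator_le {s : Set ℝ} (hs : s.OrdConnected) :
    BVNorm (s.indicator 1) ≤ 3 := by
  have hvar : (eVariationOn (s.indicator (1 : ℝ → ℝ)) (Icc 0 1)).toReal ≤ 2 :=
    ENNReal.toReal_le_of_le_ofReal (by norm_num) (by simpa using hs.eVariationOn_indicator_le)
  have hsup : sSup ((fun x => |s.indicator (1 : ℝ → ℝ) x|) '' Icc 0 1) ≤ 1 := by
    refine csSup_le ((nonempty_Icc.2 zero_le_one).image _) ?_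
    rintro _ ⟨x, -, rfl⟩
    by_cases hx : x ∈ s <;> simp [hx]
  unfold BVNorm
  linarith

lemma DecayL1BV.nonneg {T : ℝ → ℝ} {μ : Measure ℝ} [IsProbabilityMeasure μ] {p : ℕ → ℝ}
    (h : DecayL1BV T μ p) (n : ℕ) : 0 ≤ p n := by
  have hvar : eVariationOn (fun _ : ℝ => (1 : ℝ)) (Icc 0 1) = 0 :=
    eVariationOn.constant_on (by simp [Set.Subsingleton])
  have hnorm : BVNorm (fun _ => 1) = 1 := by
    have himage : (fun _ : ℝ => (1 : ℝ)) '' Icc 0 1 = {1} :=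
      (nonempty_Icc.2 zero_le_one).image_const 1
    simp [BVNorm, hvar, himage]
  have := h n (fun _ => 1) (fun _ => 1) (integrable_const 1)
    (by simp [BoundedVariationOn, hvar])
  rw [hnorm] at this
  simpa using this

section Fibration

variable {φ : ℝ → ℤ} {S : Finset ℤ} {E : ℤ → Set ℝ}

lemma measurableSet_fiberwise (hφ : Measurable φ) (hE : ∀ i, MeasurableSet (E i)) :
    MeasurableSet {q : ℝ × ℝ | q.2 ∈ E (φ q.1)} := by
  have : {q : ℝ × ℝ | q.2 ∈ E (φ q.1)} = ⋃ i, (φ ⁻¹' {i}) ×ˢ E i := by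
    ext q
    simp
  rw [this]
  exact .iUnion fun i => (hφ (measurableSet_singleton i)).prod (hE i)

lemma measureReal_fiberwise (hφ : Measurable φ) (hE : ∀ i, MeasurableSet (E i))
    (ν : Measure (ℝ × ℝ)) [IsFiniteMeasure ν] (hν : ∀ᵐ q ∂ν, φ q.1 ∈ S) :
    ν.real {q | q.2 ∈ E (φ q.1)} = ∑ i ∈ S, ν.real ((φ ⁻¹' {i}) ×ˢ E i) := by
  rw [← measureReal_biUnion_finset]
  · refine measureReal_congr ?_
    filter_upwards [hν] with q hq
    refine propext ?_
    change q.2 ∈ E (φ q.1) ↔ q ∈ ⋃ i ∈ S, (φ ⁻¹' {i}) ×ˢ E i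
    simp [hq]
  · intro i _ j _ hij
    refine Set.disjoint_left.2 fun q hqi hqj => hij ?_
    exact hqi.1.symm.trans hqj.1
  · exact fun i _ => (hφ (measurableSet_singleton i)).prod (hE i)

lemma DecayL1BV.abs_measureReal_prod_sub_le {T : ℝ → ℝ} {μ : Measure ℝ}
    [IsProbabilityMeasure μ] {p : ℕ → ℝ} (h : DecayL1BV T μ p) (hT : Measurable T) (n : ℕ)
    {A B : Set ℝ} (hA : MeasurableSet A) (hB : B.OrdConnected) :
    |(μ.map fun x => (T^[n] x, x)).real (A ×ˢ B) - (μ.prod μ).real (A ×ˢ B)| ≤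
      μ.real A * (3 * p n) := by
  have hTn : Measurable (T^[n]) := hT.iterate n
  have hvar : BoundedVariationOn (B.indicator (1 : ℝ → ℝ)) (Icc 0 1) :=
    (hB.eVariationOn_indicator_le.trans_lt (by norm_num)).ne
  have hdec := h n (A.indicator 1) (B.indicator 1)
    ((integrable_const (1 : ℝ)).indicator hA) hvar
  have hmul : (fun x => A.indicator (1 : ℝ → ℝ) (T^[n] x) * B.indicator 1 x) =
      (T^[n] ⁻¹' A ∩ B).indicator 1 := by
    ext x
    by_cases hxA : T^[n] x ∈ A <;> by_cases hxB : x ∈ B <;> simp [hxA, hxB, indicator]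
  have habs : (fun x => |A.indicator (1 : ℝ → ℝ) x|) = A.indicator 1 := by
    ext x
    by_cases hx : x ∈ A <;> simp [hx]
  rw [hmul, habs, integral_indicator_one ((hTn hA).inter hB.measurableSet),
    integral_indicator_one hA, integral_indicator_one hB.measurableSet] at hdec
  rw [map_measureReal_apply (by fun_prop) (hA.prod hB.measurableSet), measureReal_prod_prod]
  refine hdec.trans ?_
  rw [mul_assoc]
  gcongr
  exacts [h.nonneg n, hB.BVNorm_indicator_le]

lemma DecayL1BV.abs_measureReal_fiberwise_sub_le {T : ℝ → ℝ} {μ : Measure ℝ}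
    [IsProbabilityMeasure μ] {p : ℕ → ℝ} (h : DecayL1BV T μ p) (hT : MeasurePreserving T μ μ)
    (n : ℕ) (hφ : Measurable φ) (hE : ∀ i, (E i).OrdConnected) (hS : ∀ᵐ x ∂μ, φ x ∈ S) :
    |(μ.map fun x => (T^[n] x, x)).real {q | q.2 ∈ E (φ q.1)} -
      (μ.prod μ).real {q | q.2 ∈ E (φ q.1)}| ≤ 3 * p n := by
  have hTn : Measurable (T^[n]) := hT.measurable.iterate n
  have hgraph : Measurable fun x => (T^[n] x, x) := by fun_prop
  have hmeas : MeasurableSet {q : ℝ × ℝ | φ q.1 ∈ S} :=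
    (hφ.comp measurable_fst) S.measurableSet
  have := Measure.isProbabilityMeasure_map hgraph.aemeasurable (μ := μ)
  rw [measureReal_fiberwise hφ (fun i => (hE i).measurableSet) _
      ((ae_map_iff hgraph.aemeasurable hmeas).2 ((hT.iterate n).quasiMeasurePreserving.ae hS)),
    measureReal_fiberwise hφ (fun i => (hE i).measurableSet) _
      (Measure.quasiMeasurePreserving_fst.ae hS), ← Finset.sum_sub_distrib]
  calc _ ≤ ∑ i ∈ S, μ.real (φ ⁻¹' {i}) * (3 * p n) :=
        (Finset.abs_sum_le_sum_abs _ _).trans (Finset.sum_le_sum fun i _ =>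
          h.abs_measureReal_prod_sub_le hT.measurable n (hφ (measurableSet_singleton i)) (hE i))
    _ = μ.real (⋃ i ∈ S, φ ⁻¹' {i}) * (3 * p n) := by
        rw [← Finset.sum_mul, measureReal_biUnion_finset]
        · intro i _ j _ hij
          exact Set.disjoint_left.2 fun x hi hj => hij (hi.symm.trans hj)
        · exact fun i _ => hφ (measurableSet_singleton i)
    _ ≤ 1 * (3 * p n) := by
        gcongr
        · exact mul_nonneg (by norm_num) (h.nonneg n)
        · exact measureReal_le_one
    _ = 3 * p n := one_mul _

end Fibration

lemma floor_nat_mul_mem_Icc {x : ℝ} (hx : x ∈ Icc (0 : ℝ) 1) (m : ℕ) :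
    ⌊(m : ℝ) * x⌋ ∈ Finset.Icc (0 : ℤ) m := by
  rw [Finset.mem_Icc]
  refine ⟨Int.floor_nonneg.2 (mul_nonneg m.cast_nonneg hx.1), ?_⟩
  rw [← Int.floor_natCast (R := ℝ) m]
  exact Int.floor_mono (mul_le_of_le_one_right m.cast_nonneg hx.2)

lemma IsOpen.eventually_forall_floor_eq_mem {U : Set (ℝ × ℝ)} (hU : IsOpen U) {q : ℝ × ℝ}
    (hq : q ∈ U) :
    ∀ᶠ m : ℕ in atTop, ∀ x : ℝ, ⌊(m : ℝ) * x⌋ = ⌊(m : ℝ) * q.1⌋ → (x, q.2) ∈ U := by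
  obtain ⟨ε, hε, hball⟩ := Metric.isOpen_iff.1 hU q hq
  obtain ⟨M, hM⟩ := exists_nat_gt (1 / ε)
  filter_upwards [eventually_ge_atTop M] with m hm x hx
  refine hball ?_
  have hMm : (M : ℝ) ≤ m := by exact_mod_cast hm
  have hpos : (0 : ℝ) < m := (one_div_pos.2 hε).trans (hM.trans_le hMm)
  have hlt := Int.abs_sub_lt_one_of_floor_eq_floor hx
  rw [← mul_sub, abs_mul, abs_of_pos hpos] at hlt
  have hmε : 1 < m * ε := (div_lt_iff₀ hε).1 (hM.trans_le hMm)
  rw [Metric.mem_ball, Prod.dist_eq, dist_self, max_eq_left dist_nonneg, Real.dist_eq]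
  exact lt_of_mul_lt_mul_left (hlt.trans hmε) hpos.le

lemma convex_floor_nat_mul_fiber (m : ℕ) (i : ℤ) : Convex ℝ {x : ℝ | ⌊(m : ℝ) * x⌋ = i} := by
  have hmono : Monotone fun x : ℝ => ⌊(m : ℝ) * x⌋ := fun x y hxy =>
    Int.floor_mono (mul_le_mul_of_nonneg_left hxy m.cast_nonneg)
  exact (ordConnected_singleton.preimage_mono hmono : OrdConnected _).convex

lemma Convex.exists_ordConnected_fiberwise_approx {Y : Set (ℝ × ℝ)} (hY : Convex ℝ Y)
    (hYoc : IsOpen Y ∨ IsClosed Y) :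
    ∃ E : ℕ → ℤ → Set ℝ, (∀ m i, (E m i).OrdConnected) ∧
      ∀ q : ℝ × ℝ, ∀ᶠ m : ℕ in atTop, q.2 ∈ E m ⌊(m : ℝ) * q.1⌋ ↔ q ∈ Y := by
  rcases hYoc with hopen | hclosed
  · refine ⟨fun m i => {y | ∀ x : ℝ, ⌊(m : ℝ) * x⌋ = i → (x, y) ∈ Y}, fun m i => ?_,
      fun q => ?_⟩
    · refine Convex.ordConnected fun y₁ h₁ y₂ h₂ a b ha hb hab x hx => ?_
      have h := hY (h₁ x hx) (h₂ x hx) ha hb hab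
      simpa [← add_mul, hab] using h
    · by_cases hq : q ∈ Y
      · filter_upwards [hopen.eventually_forall_floor_eq_mem hq] with m hm
        exact iff_of_true hm hq
      · exact Eventually.of_forall fun m => ⟨fun h => h q.1 rfl, fun h => absurd h hq⟩
  · refine ⟨fun m i => Prod.snd '' (Y ∩ {x : ℝ | ⌊(m : ℝ) * x⌋ = i} ×ˢ univ), fun m i => ?_,
      fun q => ?_⟩
    · exact ((hY.inter ((convex_floor_nat_mul_fiber m i).prod convex_univ)).linear_image
        (LinearMap.snd ℝ ℝ ℝ)).ordConnected
    · by_cases hq : q ∈ Y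
      · exact Eventually.of_forall fun m => iff_of_true ⟨q, ⟨hq, rfl, trivial⟩, rfl⟩ hq
      · filter_upwards [hclosed.isOpen_compl.eventually_forall_floor_eq_mem hq] with m hm
        refine iff_of_false ?_ hq
        rintro ⟨⟨x, y⟩, ⟨hxy, hx, -⟩, rfl⟩
        exact hm x hx hxy

theorem stmt8 (T : ℝ → ℝ) (hmaps : Set.MapsTo T (Set.Icc 0 1) (Set.Icc 0 1))
    (μ : Measure ℝ) [IsProbabilityMeasure μ] (hsupp : μ (Set.Icc 0 1) = 1)
    (hpres : MeasurePreserving T μ μ)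
    (p : ℕ → ℝ) (hsum : Summable p) (hdecay : DecayL1BV T μ p)
    (F : ℝ × ℝ → ℝ) (Y : Set (ℝ × ℝ))
    (hYsub : Y ⊆ Set.Icc 0 1 ×ˢ Set.Icc 0 1) (hYconv : Convex ℝ Y)
    (hYoc : IsOpen Y ∨ IsClosed Y) (hF : F = Y.indicator 1) (n : ℕ) :
    |(∫ x, F (T^[n] x, x) ∂μ) - ∫ x, ∫ y, F (x, y) ∂μ ∂μ| ≤ 3 * p n := by
  subst hF
  have hYmeas : MeasurableSet Y := hYoc.elim IsOpen.measurableSet IsClosed.measurableSet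
  have hTn : Measurable (T^[n]) := hpres.measurable.iterate n
  have hgraph : Measurable fun x => (T^[n] x, x) := by fun_prop
  have := Measure.isProbabilityMeasure_map hgraph.aemeasurable (μ := μ)
  have hmem : ∀ᵐ x ∂μ, x ∈ Icc (0 : ℝ) 1 := (mem_ae_iff_prob_eq_one measurableSet_Icc).2 hsupp
  have hdiag : ∫ x, Y.indicator (1 : ℝ × ℝ → ℝ) (T^[n] x, x) ∂μ =
      (μ.map fun x => (T^[n] x, x)).real Y := by
    rw [← integral_indicator_one hYmeas, integral_map hgraph.aemeasurable
      (measurable_one.indicator hYmeas).aestronglyMeasurable]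
  have hprod : ∫ x, ∫ y, Y.indicator (1 : ℝ × ℝ → ℝ) (x, y) ∂μ ∂μ = (μ.prod μ).real Y := by
    rw [← integral_indicator_one hYmeas]
    exact (integral_prod _ ((integrable_const (1 : ℝ)).indicator hYmeas)).symm
  rw [hdiag, hprod]
  obtain ⟨E, hE, hlim⟩ := hYconv.exists_ordConnected_fiberwise_approx hYoc
  have hφ : ∀ m : ℕ, Measurable fun x : ℝ => ⌊(m : ℝ) * x⌋ := fun m => by fun_prop
  have htendsto : ∀ ν : Measure (ℝ × ℝ), IsFiniteMeasure ν →
      Tendsto (fun m : ℕ => ν.real {q | q.2 ∈ E m ⌊(m : ℝ) * q.1⌋}) atTop (𝓝 (ν.real Y)) :=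
    fun ν _ => (ENNReal.tendsto_toReal (measure_ne_top ν Y)).comp
      (tendsto_measure_of_ae_tendsto_indicator_of_isFiniteMeasure atTop hYmeas
        (fun m => measurableSet_fiberwise (hφ m) fun i => (hE m i).measurableSet)
        (ae_of_all _ hlim))
  exact le_of_tendsto ((htendsto _ inferInstance).sub (htendsto _ inferInstance)).abs
    (Eventually.of_forall fun m => hdecay.abs_measureReal_fiberwise_sub_le hpres n (hφ m) (hE m)
      (hmem.mono fun x hx => floor_nat_mul_mem_Icc hx m))
end

section
/- Let T : [0,1] → [0,1] be a mixing piecewise C² expanding map with an ergodic invariant absolutely continuous probability measure μ whose density h is of bounded variation and satisfies c⁻¹ ≤ h ≤ c for some c ≥ 1, and let (r_n) be a sequence of nonnegative reals. Set H = 4c⁴. Then there exist constants C > 0 and τ > 0 such that for all m, n ∈ ℕ, μ(E_n ∩ E_{n+m}) ≤ H μ(E_n) μ(E_{n+m}) + C (e^{−τ n} + e^{−τ m}). -/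
open MeasureTheory

/-- `T` is a piecewise `C²` expanding map of `[0,1]` with expansion constants
`1 < lam ≤ Lam`. -/
def IsPiecewiseC2ExpandingWith (T : ℝ → ℝ) (lam Lam : ℝ) : Prop :=
  1 < lam ∧ lam ≤ Lam ∧ Set.MapsTo T (Set.Icc 0 1) (Set.Icc 0 1) ∧
  ∃ (N : ℕ) (a : ℕ → ℝ), 0 < N ∧ a 0 = 0 ∧ a N = 1 ∧ (∀ i < N, a i < a (i + 1)) ∧
    ∀ i < N, ∃ g : ℝ → ℝ,
      ContDiffOn ℝ 2 g (Set.Icc (a i) (a (i + 1))) ∧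
      Set.EqOn T g (Set.Ico (a i) (a (i + 1))) ∧
      ∀ x ∈ Set.Icc (a i) (a (i + 1)),
        lam ≤ |derivWithin g (Set.Icc (a i) (a (i + 1))) x| ∧
        |derivWithin g (Set.Icc (a i) (a (i + 1))) x| ≤ Lam

/-- `T` is a piecewise `C²` expanding map of `[0,1]`. -/
def IsPiecewiseC2Expanding (T : ℝ → ℝ) : Prop :=
  ∃ lam Lam : ℝ, IsPiecewiseC2ExpandingWith T lam Lam

/-- The system `(T, μ)` is mixing. -/
def Mixing (T : ℝ → ℝ) (μ : Measure ℝ) : Prop :=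
  ∀ A B : Set ℝ, MeasurableSet A → MeasurableSet B →
    Filter.Tendsto (fun n => μ (A ∩ T^[n] ⁻¹' B)) Filter.atTop (nhds (μ A * μ B))

/-- The set `E_n = {x ∈ [0,1] : |T^n(x) − x| < r_n}`. -/
def En (T : ℝ → ℝ) (r : ℕ → ℝ) (n : ℕ) : Set ℝ :=
  {x ∈ Set.Icc (0:ℝ) 1 | |T^[n] x - x| < r n}

section DecayOfCorrelations

open Set

/-- Away from the finite set `S`, the map `T` is differentiable on `(0, 1)` with
`lam ≤ |T'| ≤ Lam`, and `T'` is `L`-Lipschitz on each interval avoiding `S`. -/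
structure IsExpandingOff (T : ℝ → ℝ) (S : Set ℝ) (lam Lam L : ℝ) : Prop where
  finite : S.Finite
  lam_pos : 0 < lam
  Lam_nonneg : 0 ≤ Lam
  L_nonneg : 0 ≤ L
  differentiableAt : ∀ x ∈ Ioo (0 : ℝ) 1 \ S, DifferentiableAt ℝ T x
  le_abs_deriv : ∀ x ∈ Ioo (0 : ℝ) 1 \ S, lam ≤ |deriv T x|
  abs_deriv_le : ∀ x ∈ Ioo (0 : ℝ) 1 \ S, |deriv T x| ≤ Lam
  lipschitz : ∀ x y, x ≤ y → Icc x y ⊆ Ioo (0 : ℝ) 1 \ S →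
    |deriv T x - deriv T y| ≤ L * |x - y|

theorem Set.Finite.of_separated {A S : Set ℝ} (hS : S.Finite)
    (h : ∀ x ∈ A, ∀ y ∈ A, x < y → ∃ s ∈ S, x ≤ s ∧ s < y) : A.Finite := by
  refine Set.Finite.of_injOn (f := fun x => S ∩ Iio x) (t := 𝒫 S)
    (fun x _ => inter_subset_left) ?_ hS.finite_subsets
  have key : ∀ x ∈ A, ∀ y ∈ A, x < y → S ∩ Iio x ≠ S ∩ Iio y := by
    intro x hx y hy hxy he
    obtain ⟨s, hs, h1, h2⟩ := h x hx y hy hxy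
    have : s ∈ S ∩ Iio x := he ▸ ⟨hs, h2⟩
    exact absurd this.2 (not_lt.mpr h1)
  intro x hx y hy hxy
  rcases lt_trichotomy x y with h1 | h1 | h1
  · exact absurd hxy (key x hx y hy h1)
  · exact h1
  · exact absurd hxy.symm (key y hy x hx h1)

theorem IsExpandingOff.finite_preimage {T : ℝ → ℝ} {S : Set ℝ} {lam Lam L : ℝ}
    (h : IsExpandingOff T S lam Lam L) (b : ℝ) : ((Ioo (0 : ℝ) 1 \ S) ∩ T ⁻¹' {b}).Finite := by
  refine Set.Finite.of_separated h.finite ?_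
  rintro x ⟨hx, hxb⟩ y ⟨hy, hyb⟩ hxy
  by_contra! hcon
  have hsub : Icc x y ⊆ Ioo (0 : ℝ) 1 \ S := by
    intro z hz
    refine ⟨⟨hx.1.1.trans_le hz.1, hz.2.trans_lt hy.1.2⟩, fun hzS => ?_⟩
    rcases hz.2.eq_or_lt with rfl | hlt
    · exact hy.2 hzS
    · exact absurd hlt (not_lt.mpr (hcon z hzS hz.1))
  obtain ⟨z, hz, hz0⟩ := exists_deriv_eq_zero hxy
    (fun z hz => (h.differentiableAt z (hsub hz)).continuousAt.continuousWithinAt)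
    ((show T x = b from hxb).trans (show T y = b from hyb).symm)
  have := h.le_abs_deriv z (hsub ⟨hz.1.le, hz.2.le⟩)
  rw [hz0, abs_zero] at this
  linarith [h.lam_pos]

theorem IsExpandingOff.abs_sub_le {T : ℝ → ℝ} {S : Set ℝ} {lam Lam L : ℝ}
    (h : IsExpandingOff T S lam Lam L) {x y : ℝ} (hxy : x ≤ y)
    (hsub : Icc x y ⊆ Ioo (0 : ℝ) 1 \ S) : |T x - T y| ≤ Lam * |x - y| := by
  have := (convex_Icc x y).norm_image_sub_le_of_norm_deriv_le
    (fun z hz => h.differentiableAt z (hsub hz))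
    (fun z hz => by simpa using h.abs_deriv_le z (hsub hz))
    (right_mem_Icc.mpr hxy) (left_mem_Icc.mpr hxy)
  simpa using this

theorem IsExpandingOff.comp {T₁ T₂ : ℝ → ℝ} {S₁ S₂ : Set ℝ} {lam₁ lam₂ Lam₁ Lam₂ L₁ L₂ : ℝ}
    (h₂ : IsExpandingOff T₂ S₂ lam₂ Lam₂ L₂) (h₁ : IsExpandingOff T₁ S₁ lam₁ Lam₁ L₁)
    (hmaps : MapsTo T₁ (Icc 0 1) (Icc 0 1)) :
    ∃ S, IsExpandingOff (T₂ ∘ T₁) S (lam₂ * lam₁) (Lam₂ * Lam₁)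
      (L₂ * Lam₁ * Lam₁ + Lam₂ * L₁) := by
  set S₂' : Set ℝ := S₂ ∪ {0, 1}
  have hS₂' : S₂'.Finite := h₂.finite.union (by simp)
  set S : Set ℝ := S₁ ∪ (Ioo (0 : ℝ) 1 \ S₁) ∩ T₁ ⁻¹' S₂'
  have hfin : S.Finite := by
    refine h₁.finite.union ?_
    have : (Ioo (0 : ℝ) 1 \ S₁) ∩ T₁ ⁻¹' S₂' =
        ⋃ b ∈ S₂', (Ioo (0 : ℝ) 1 \ S₁) ∩ T₁ ⁻¹' {b} := by
      rw [← inter_iUnion₂, ← preimage_iUnion₂, biUnion_of_singleton]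
    rw [this]
    exact hS₂'.biUnion fun b _ => h₁.finite_preimage b
  have hm : ∀ x ∈ Ioo (0 : ℝ) 1 \ S, x ∈ Ioo (0 : ℝ) 1 \ S₁ ∧ T₁ x ∈ Ioo (0 : ℝ) 1 \ S₂ := by
    intro x hx
    have hx1 : x ∈ Ioo (0 : ℝ) 1 \ S₁ := ⟨hx.1, fun h => hx.2 (Or.inl h)⟩
    have hT : T₁ x ∉ S₂' := fun h => hx.2 (Or.inr ⟨hx1, h⟩)
    have hI := hmaps ⟨hx.1.1.le, hx.1.2.le⟩
    refine ⟨hx1, ⟨lt_of_le_of_ne hI.1 ?_, lt_of_le_of_ne hI.2 ?_⟩, fun h => hT (Or.inl h)⟩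
    · intro h; exact hT (Or.inr (by simp [← h]))
    · intro h; exact hT (Or.inr (by simp [h]))
  have hder : ∀ x ∈ Ioo (0 : ℝ) 1 \ S,
      deriv (T₂ ∘ T₁) x = deriv T₂ (T₁ x) * deriv T₁ x := fun x hx =>
    deriv_comp x (h₂.differentiableAt _ (hm x hx).2) (h₁.differentiableAt _ (hm x hx).1)
  refine ⟨S, hfin, mul_pos h₂.lam_pos h₁.lam_pos, mul_nonneg h₂.Lam_nonneg h₁.Lam_nonneg,
    ?_, ?_, ?_, ?_, ?_⟩
  · have := h₁.Lam_nonneg; have := h₂.Lam_nonneg; have := h₁.L_nonneg; have := h₂.L_nonneg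
    positivity
  · intro x hx
    exact (h₂.differentiableAt _ (hm x hx).2).comp x (h₁.differentiableAt _ (hm x hx).1)
  · intro x hx
    rw [hder x hx, abs_mul]
    exact mul_le_mul (h₂.le_abs_deriv _ (hm x hx).2) (h₁.le_abs_deriv _ (hm x hx).1)
      h₁.lam_pos.le (abs_nonneg _)
  · intro x hx
    rw [hder x hx, abs_mul]
    exact mul_le_mul (h₂.abs_deriv_le _ (hm x hx).2) (h₁.abs_deriv_le _ (hm x hx).1)
      (abs_nonneg _) h₂.Lam_nonneg
  · intro x y hxy hsub
    have hx := hsub (left_mem_Icc.mpr hxy)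
    have hy := hsub (right_mem_Icc.mpr hxy)
    have hsub₁ : Icc x y ⊆ Ioo (0 : ℝ) 1 \ S₁ := fun z hz => (hm z (hsub hz)).1
    have himg : uIcc (T₁ x) (T₁ y) ⊆ Ioo (0 : ℝ) 1 \ S₂ := by
      have hc : ContinuousOn T₁ (uIcc x y) := by
        rw [uIcc_of_le hxy]
        exact fun z hz => (h₁.differentiableAt z (hsub₁ hz)).continuousAt.continuousWithinAt
      intro w hw
      obtain ⟨z, hz, rfl⟩ := intermediate_value_uIcc hc hw
      rw [uIcc_of_le hxy] at hz
      exact (hm z (hsub hz)).2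
    have hlip₂ : |deriv T₂ (T₁ x) - deriv T₂ (T₁ y)| ≤ L₂ * |T₁ x - T₁ y| := by
      rcases le_total (T₁ x) (T₁ y) with hle | hle
      · rw [uIcc_of_le hle] at himg
        exact h₂.lipschitz _ _ hle himg
      · rw [uIcc_of_ge hle] at himg
        rw [abs_sub_comm, abs_sub_comm (T₁ x)]
        exact h₂.lipschitz _ _ hle himg
    have hlip₁ := h₁.lipschitz x y hxy hsub₁
    have hT := h₁.abs_sub_le hxy hsub₁
    rw [hder x hx, hder y hy]
    have e : deriv T₂ (T₁ x) * deriv T₁ x - deriv T₂ (T₁ y) * deriv T₁ y =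
      (deriv T₂ (T₁ x) - deriv T₂ (T₁ y)) * deriv T₁ x +
        deriv T₂ (T₁ y) * (deriv T₁ x - deriv T₁ y) := by ring
    rw [e]
    refine (abs_add_le _ _).trans ?_
    rw [abs_mul, abs_mul]
    have a1 : |deriv T₂ (T₁ x) - deriv T₂ (T₁ y)| * |deriv T₁ x| ≤
        (L₂ * (Lam₁ * |x - y|)) * Lam₁ :=
      mul_le_mul (hlip₂.trans (mul_le_mul_of_nonneg_left hT h₂.L_nonneg))
        (h₁.abs_deriv_le _ (hm x hx).1) (abs_nonneg _)
        (mul_nonneg h₂.L_nonneg (mul_nonneg h₁.Lam_nonneg (abs_nonneg _)))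
    have a2 : |deriv T₂ (T₁ y)| * |deriv T₁ x - deriv T₁ y| ≤ Lam₂ * (L₁ * |x - y|) :=
      mul_le_mul (h₂.abs_deriv_le _ (hm y hy).2) hlip₁ (abs_nonneg _) h₂.Lam_nonneg
    linarith

theorem IsExpandingOff.iterate {T : ℝ → ℝ} {S : Set ℝ} {lam Lam L : ℝ}
    (h : IsExpandingOff T S lam Lam L) (hmaps : MapsTo T (Icc 0 1) (Icc 0 1)) (n : ℕ) :
    ∃ S' Lam' L', IsExpandingOff T^[n] S' (lam ^ n) Lam' L' := by
  induction n with
  | zero =>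
    refine ⟨∅, 1, 0, finite_empty, by simp, zero_le_one, le_rfl, ?_, ?_, ?_, ?_⟩ <;> simp
  | succ n ih =>
    obtain ⟨S', Lam', L', h'⟩ := ih
    obtain ⟨S'', h''⟩ := h'.comp h hmaps
    rw [Function.iterate_succ, pow_succ]
    exact ⟨S'', _, _, h''⟩

theorem IsPiecewiseC2ExpandingWith.exists_isExpandingOff {T : ℝ → ℝ} {lam Lam : ℝ}
    (hT : IsPiecewiseC2ExpandingWith T lam Lam) : ∃ S L, IsExpandingOff T S lam Lam L := by
  obtain ⟨h1, h2, -, N, a, hN, ha0, haN, hlt, hg⟩ := hT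
  choose! g hgC hgT hgd using hg
  have hlip : ∀ i < N, ∃ K : ℝ, 0 ≤ K ∧ ∀ x ∈ Icc (a i) (a (i + 1)), ∀ y ∈ Icc (a i) (a (i + 1)),
      |derivWithin (g i) (Icc (a i) (a (i + 1))) x -
        derivWithin (g i) (Icc (a i) (a (i + 1))) y| ≤ K * |x - y| := by
    intro i hi
    have hC : ContDiffOn ℝ 1 (derivWithin (g i) (Icc (a i) (a (i + 1)))) (Icc (a i) (a (i + 1))) :=
      (hgC i hi).derivWithin (uniqueDiffOn_Icc (hlt i hi)) (by norm_num)
    obtain ⟨K, hK⟩ := hC.exists_lipschitzOnWith one_ne_zero (convex_Icc _ _) isCompact_Icc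
    refine ⟨K, K.2, fun x hx y hy => ?_⟩
    simpa [Real.dist_eq] using hK.dist_le_mul x hx y hy
  choose! K hK0 hK using hlip
  have hloc : ∀ x ∈ Ioo (0 : ℝ) 1 \ (a '' Iic N), ∃ i < N, x ∈ Ioo (a i) (a (i + 1)) := by
    intro x hx
    have hex : ∃ j, j ≤ N ∧ x ≤ a j := ⟨N, le_rfl, haN ▸ hx.1.2.le⟩
    classical
    obtain ⟨hj1, hj2⟩ := Nat.find_spec hex
    set j := Nat.find hex with hj
    have hj0 : j ≠ 0 := by
      intro h0
      rw [h0, ha0] at hj2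
      exact absurd hx.1.1 (not_lt.mpr hj2)
    obtain ⟨i, hi⟩ := Nat.exists_eq_succ_of_ne_zero hj0
    refine ⟨i, by omega, ?_, ?_⟩
    · by_contra hcon
      exact Nat.find_min hex (m := i) (by omega) ⟨by omega, not_lt.mp hcon⟩
    · rw [← Nat.succ_eq_add_one, ← hi]
      refine lt_of_le_of_ne hj2 fun he => hx.2 ⟨j, hj1, he.symm⟩
  have hev : ∀ i < N, ∀ x ∈ Ioo (a i) (a (i + 1)),
      HasDerivAt T (derivWithin (g i) (Icc (a i) (a (i + 1))) x) x := by
    intro i hi x hx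
    have hd : DifferentiableWithinAt ℝ (g i) (Icc (a i) (a (i + 1))) x :=
      (hgC i hi).differentiableOn (by norm_num) x ⟨hx.1.le, hx.2.le⟩
    refine (hd.hasDerivWithinAt.hasDerivAt (Icc_mem_nhds hx.1 hx.2)).congr_of_eventuallyEq ?_
    filter_upwards [Ioo_mem_nhds hx.1 hx.2] with y hy
    exact hgT i hi ⟨hy.1.le, hy.2⟩
  refine ⟨a '' Iic N, ∑ i ∈ Finset.range N, K i, (finite_Iic N).image a, by linarith,
    by linarith, Finset.sum_nonneg fun i hi => hK0 i (Finset.mem_range.mp hi), ?_, ?_, ?_, ?_⟩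
  · intro x hx
    obtain ⟨i, hi, hxi⟩ := hloc x hx
    exact (hev i hi x hxi).differentiableAt
  · intro x hx
    obtain ⟨i, hi, hxi⟩ := hloc x hx
    rw [(hev i hi x hxi).deriv]
    exact (hgd i hi x ⟨hxi.1.le, hxi.2.le⟩).1
  · intro x hx
    obtain ⟨i, hi, hxi⟩ := hloc x hx
    rw [(hev i hi x hxi).deriv]
    exact (hgd i hi x ⟨hxi.1.le, hxi.2.le⟩).2
  · intro x y hxy hsub
    obtain ⟨i, hi, hxi⟩ := hloc x (hsub (left_mem_Icc.mpr hxy))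
    have hyi : y < a (i + 1) := by
      by_contra hcon
      exact (hsub ⟨hxi.2.le, not_lt.mp hcon⟩).2 ⟨i + 1, hi, rfl⟩
    have hyi' : y ∈ Ioo (a i) (a (i + 1)) := ⟨hxi.1.trans_le hxy, hyi⟩
    rw [(hev i hi x hxi).deriv, (hev i hi y hyi').deriv]
    refine (hK i hi x ⟨hxi.1.le, hxi.2.le⟩ y ⟨hyi'.1.le, hyi'.2.le⟩).trans ?_
    exact mul_le_mul_of_nonneg_right (Finset.single_le_sum
      (fun j hj => hK0 j (Finset.mem_range.mp hj)) (Finset.mem_range.mpr hi)) (abs_nonneg _)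

/-- The total variation of `f` on `s` as a real number. -/
noncomputable def realVariation (f : ℝ → ℝ) (s : Set ℝ) : ℝ := (eVariationOn f s).toReal

theorem realVariation_nonneg (f : ℝ → ℝ) (s : Set ℝ) : 0 ≤ realVariation f s :=
  ENNReal.toReal_nonneg

theorem BoundedVariationOn.sum_abs_le {f : ℝ → ℝ} {s : Set ℝ} (hf : BoundedVariationOn f s)
    {u : ℕ → ℝ} (hu : Monotone u) (us : ∀ i, u i ∈ s) (n : ℕ) :
    ∑ i ∈ Finset.range n, |f (u (i + 1)) - f (u i)| ≤ realVariation f s := by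
  have h1 := eVariationOn.sum_le (f := f) (n := n) hu us
  have h2 : ∑ i ∈ Finset.range n, edist (f (u (i + 1))) (f (u i)) =
      ENNReal.ofReal (∑ i ∈ Finset.range n, |f (u (i + 1)) - f (u i)|) := by
    rw [ENNReal.ofReal_sum_of_nonneg fun i _ => abs_nonneg _]
    exact Finset.sum_congr rfl fun i _ => by rw [edist_dist, Real.dist_eq]
  rw [h2] at h1
  exact (ENNReal.ofReal_le_iff_le_toReal hf).mp h1

theorem boundedVariationOn_of_eVariationOn_le {f : ℝ → ℝ} {s : Set ℝ} {C : ℝ} (hC : 0 ≤ C)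
    (h : eVariationOn f s ≤ ENNReal.ofReal C) :
    BoundedVariationOn f s ∧ realVariation f s ≤ C :=
  ⟨ne_top_of_le_ne_top ENNReal.ofReal_ne_top h, ENNReal.toReal_le_of_le_ofReal hC h⟩

theorem boundedVariationOn_of_sum_abs_le {f : ℝ → ℝ} {s : Set ℝ} {C : ℝ} (hC : 0 ≤ C)
    (h : ∀ (n : ℕ) (u : ℕ → ℝ), Monotone u → (∀ i, u i ∈ s) →
      ∑ i ∈ Finset.range n, |f (u (i + 1)) - f (u i)| ≤ C) :
    BoundedVariationOn f s ∧ realVariation f s ≤ C := by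
  refine boundedVariationOn_of_eVariationOn_le hC (iSup_le ?_)
  rintro ⟨n, u, hu, us⟩
  have h2 : ∑ i ∈ Finset.range n, edist (f (u (i + 1))) (f (u i)) =
      ENNReal.ofReal (∑ i ∈ Finset.range n, |f (u (i + 1)) - f (u i)|) := by
    rw [ENNReal.ofReal_sum_of_nonneg fun i _ => abs_nonneg _]
    exact Finset.sum_congr rfl fun i _ => by rw [edist_dist, Real.dist_eq]
  change ∑ i ∈ Finset.range n, edist (f (u (i + 1))) (f (u i)) ≤ _
  rw [h2]
  exact ENNReal.ofReal_le_ofReal (h n u hu us)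

theorem BoundedVariationOn.of_abs_sub_le {F f g : ℝ → ℝ} {s : Set ℝ} {A B : ℝ}
    (hA : 0 ≤ A) (hB : 0 ≤ B) (hf : BoundedVariationOn f s) (hg : BoundedVariationOn g s)
    (h : ∀ x ∈ s, ∀ y ∈ s, |F x - F y| ≤ A * |f x - f y| + B * |g x - g y|) :
    BoundedVariationOn F s ∧ realVariation F s ≤ A * realVariation f s + B * realVariation g s := by
  refine boundedVariationOn_of_sum_abs_le ?_ ?_
  · have := realVariation_nonneg f s
    have := realVariation_nonneg g s
    positivity
  · intro n u hu us
    calc ∑ i ∈ Finset.range n, |F (u (i + 1)) - F (u i)|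
        ≤ ∑ i ∈ Finset.range n,
          (A * |f (u (i + 1)) - f (u i)| + B * |g (u (i + 1)) - g (u i)|) :=
          Finset.sum_le_sum fun i _ => h _ (us _) _ (us _)
      _ = A * ∑ i ∈ Finset.range n, |f (u (i + 1)) - f (u i)| +
          B * ∑ i ∈ Finset.range n, |g (u (i + 1)) - g (u i)| := by
          rw [Finset.sum_add_distrib, Finset.mul_sum, Finset.mul_sum]
      _ ≤ _ := add_le_add (mul_le_mul_of_nonneg_left (hf.sum_abs_le hu us n) hA)
          (mul_le_mul_of_nonneg_left (hg.sum_abs_le hu us n) hB)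

theorem BoundedVariationOn.sub_const_mul {f g : ℝ → ℝ} {s : Set ℝ}
    (hf : BoundedVariationOn f s) (hg : BoundedVariationOn g s) (c : ℝ) :
    BoundedVariationOn (fun x => f x - c * g x) s ∧
      realVariation (fun x => f x - c * g x) s ≤ realVariation f s + |c| * realVariation g s := by
  have := BoundedVariationOn.of_abs_sub_le (F := fun x => f x - c * g x) zero_le_one
    (abs_nonneg c) hf hg fun x _ y _ => by
      rw [one_mul, ← abs_mul]
      calc |f x - c * g x - (f y - c * g y)| = |(f x - f y) - c * (g x - g y)| := by ring_nf
        _ ≤ _ := abs_sub _ _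
  simpa using this

theorem BoundedVariationOn.finset_sum {ι : Type*} (I : Finset ι) {F : ι → ℝ → ℝ} {s : Set ℝ}
    (hF : ∀ i ∈ I, BoundedVariationOn (F i) s) :
    BoundedVariationOn (fun x => ∑ i ∈ I, F i x) s ∧
      realVariation (fun x => ∑ i ∈ I, F i x) s ≤ ∑ i ∈ I, realVariation (F i) s := by
  refine boundedVariationOn_of_sum_abs_le
    (Finset.sum_nonneg fun i _ => realVariation_nonneg _ _) ?_
  intro n u hu us
  calc ∑ j ∈ Finset.range n, |∑ i ∈ I, F i (u (j + 1)) - ∑ i ∈ I, F i (u j)|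
      ≤ ∑ j ∈ Finset.range n, ∑ i ∈ I, |F i (u (j + 1)) - F i (u j)| := by
        refine Finset.sum_le_sum fun j _ => ?_
        rw [← Finset.sum_sub_distrib]
        exact Finset.abs_sum_le_sum_abs _ _
    _ = ∑ i ∈ I, ∑ j ∈ Finset.range n, |F i (u (j + 1)) - F i (u j)| := Finset.sum_comm
    _ ≤ _ := Finset.sum_le_sum fun i hi => (hF i hi).sum_abs_le hu us n

theorem BoundedVariationOn.abs_sub_le {f : ℝ → ℝ} {s : Set ℝ} (hf : BoundedVariationOn f s)
    {x y : ℝ} (hx : x ∈ s) (hy : y ∈ s) : |f x - f y| ≤ realVariation f s := by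
  rw [← Real.dist_eq]
  exact hf.dist_le hx hy

theorem BoundedVariationOn.indicator {G : ℝ → ℝ} {s : Set ℝ} (hs : s.OrdConnected) {B : ℝ}
    (hB : 0 ≤ B) (hG : BoundedVariationOn G s) (hGB : ∀ x ∈ s, |G x| ≤ B) :
    BoundedVariationOn (s.indicator G) univ ∧
      realVariation (s.indicator G) univ ≤ realVariation G s + 2 * B := by
  have hmain : eVariationOn (s.indicator G) univ ≤ eVariationOn G s + 2 * ENNReal.ofReal B := by
    refine iSup_le ?_
    rintro ⟨n, u, hu, -⟩
    change ∑ i ∈ Finset.range n,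
      edist (s.indicator G (u (i + 1))) (s.indicator G (u i)) ≤ _
    have hjump : ∀ x ∈ s, edist (G x) 0 ≤ ENNReal.ofReal B := by
      intro x hx
      rw [edist_dist, Real.dist_eq, sub_zero]
      exact ENNReal.ofReal_le_ofReal (hGB x hx)
    have key : ∀ n, ((∑ i ∈ Finset.range n,
          edist (s.indicator G (u (i + 1))) (s.indicator G (u i)) = 0) ∧ u n ∉ s) ∨
        (u n ∈ s ∧ ∑ i ∈ Finset.range n,
          edist (s.indicator G (u (i + 1))) (s.indicator G (u i)) ≤
            ENNReal.ofReal B + eVariationOn G (s ∩ Iic (u n))) ∨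
        (u n ∉ s ∧ (∃ x ∈ s, x ≤ u n) ∧ ∑ i ∈ Finset.range n,
          edist (s.indicator G (u (i + 1))) (s.indicator G (u i)) ≤
            ENNReal.ofReal B + ENNReal.ofReal B + eVariationOn G s) := by
      intro n
      induction n with
      | zero =>
        by_cases h0 : u 0 ∈ s
        · right; left; simp [h0]
        · left; simp [h0]
      | succ n ih =>
        simp only [Finset.sum_range_succ]
        rcases ih with ⟨h1, h2⟩ | ⟨h1, h2⟩ | ⟨h1, ⟨x, hx, hxn⟩, h2⟩
        · by_cases hn : u (n + 1) ∈ s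
          · right; left
            refine ⟨hn, ?_⟩
            rw [h1, zero_add, indicator_of_mem hn, indicator_of_notMem h2]
            exact (hjump _ hn).trans le_self_add
          · left
            refine ⟨?_, hn⟩
            rw [h1, zero_add, indicator_of_notMem hn, indicator_of_notMem h2, edist_self]
        · by_cases hn : u (n + 1) ∈ s
          · right; left
            refine ⟨hn, ?_⟩
            rw [indicator_of_mem hn, indicator_of_mem h1]
            refine (add_le_add_left h2 _).trans ?_
            rw [add_assoc]
            refine add_le_add_right ?_ _
            have hle : u n ≤ u (n + 1) := hu n.le_succ
            have h3 := eVariationOn.add_le_union G (s := s ∩ Iic (u n))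
              (t := {u n, u (n + 1)}) (by
                rintro x ⟨-, hx⟩ y hy
                rcases hy with rfl | rfl
                · exact hx
                · exact (show x ≤ u n from hx).trans hle)
            rw [eVariationOn.pair, edist_comm] at h3
            refine h3.trans (eVariationOn.mono _ ?_)
            rintro x (⟨hx, hx'⟩ | rfl | rfl)
            · exact ⟨hx, (show x ≤ u n from hx').trans hle⟩
            · exact ⟨h1, hle⟩
            · exact ⟨hn, mem_Iic.mpr le_rfl⟩
          · right; right
            refine ⟨hn, ⟨_, h1, hu n.le_succ⟩, ?_⟩
            rw [indicator_of_notMem hn, indicator_of_mem h1, edist_comm]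
            refine (add_le_add h2 (hjump _ h1)).trans ?_
            rw [add_right_comm]
            exact add_le_add_right (eVariationOn.mono _ inter_subset_left) _
        · have hn : u (n + 1) ∉ s := fun hn => h1 (hs.out hx hn ⟨hxn, hu n.le_succ⟩)
          right; right
          refine ⟨hn, ⟨x, hx, hxn.trans (hu n.le_succ)⟩, ?_⟩
          rw [indicator_of_notMem hn, indicator_of_notMem h1, edist_self, add_zero]
          exact h2
    rcases key n with ⟨h1, -⟩ | ⟨-, h1⟩ | ⟨-, -, h1⟩
    · rw [h1]; exact zero_le
    · refine h1.trans ?_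
      rw [two_mul, add_comm]
      exact add_le_add (eVariationOn.mono _ inter_subset_left) le_self_add
    · refine h1.trans ?_
      rw [two_mul, add_comm]
  refine boundedVariationOn_of_eVariationOn_le
    (add_nonneg (realVariation_nonneg _ _) (by positivity)) (hmain.trans_eq ?_)
  rw [ENNReal.ofReal_add (realVariation_nonneg _ _) (by positivity), realVariation,
    ENNReal.ofReal_toReal hG, ENNReal.ofReal_mul two_pos.le]
  simp

theorem BoundedVariationOn.realVariation_mono {f : ℝ → ℝ} {s t : Set ℝ}
    (hf : BoundedVariationOn f s) (hts : t ⊆ s) : realVariation f t ≤ realVariation f s :=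
  ENNReal.toReal_mono hf (eVariationOn.mono f hts)

theorem BoundedVariationOn.sum_realVariation_le {f : ℝ → ℝ} {a : ℕ → ℝ} (ha : Monotone a) {n : ℕ}
    (hf : BoundedVariationOn f (Icc (a 0) (a n))) :
    ∑ i ∈ Finset.range n, realVariation f (Icc (a i) (a (i + 1))) ≤
      realVariation f (Icc (a 0) (a n)) := by
  rw [realVariation, ← eVariationOn.sum' f ha, ENNReal.toReal_sum]
  · rfl
  · intro i hi
    have hi := Finset.mem_range.mp hi
    exact hf.mono (Icc_subset_Icc (ha (Nat.zero_le _)) (ha (by omega)))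

theorem BoundedVariationOn.aemeasurable {f : ℝ → ℝ} {s : Set ℝ} (hs : MeasurableSet s)
    (hf : BoundedVariationOn f s) : AEMeasurable f (volume.restrict s) := by
  obtain ⟨p, q, hp, hq, h⟩ := hf.locallyBoundedVariationOn.exists_monotoneOn_sub_monotoneOn
  rw [h]
  exact (aemeasurable_restrict_of_monotoneOn hs hp).sub (aemeasurable_restrict_of_monotoneOn hs hq)

theorem BoundedVariationOn.exists_abs_le {f : ℝ → ℝ} {s : Set ℝ} (hf : BoundedVariationOn f s) :
    ∃ B, ∀ x ∈ s, |f x| ≤ B := by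
  rcases s.eq_empty_or_nonempty with rfl | ⟨y, hy⟩
  · exact ⟨0, by simp⟩
  · refine ⟨realVariation f s + |f y|, fun x hx => ?_⟩
    have := hf.abs_sub_le hx hy
    have := abs_sub_abs_le_abs_sub (f x) (f y)
    linarith

theorem BoundedVariationOn.integrableOn_mul {f ψ : ℝ → ℝ} {s : Set ℝ} (hs : MeasurableSet s)
    (hs' : volume s ≠ ⊤) (hf : BoundedVariationOn f s) (hψ : Measurable ψ)
    (hψ1 : ∀ x, |ψ x| ≤ 1) : IntegrableOn (fun x => f x * ψ x) s := by
  obtain ⟨B, hB⟩ := hf.exists_abs_le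
  refine IntegrableOn.of_bound hs'.lt_top
    ((hf.aemeasurable hs).mul hψ.aemeasurable).aestronglyMeasurable B ?_
  refine (ae_restrict_iff' hs).mpr (Filter.Eventually.of_forall fun x hx => ?_)
  rw [norm_mul, Real.norm_eq_abs, Real.norm_eq_abs]
  nlinarith [hB x hx, hψ1 x, abs_nonneg (f x), abs_nonneg (ψ x)]

theorem BoundedVariationOn.integrableOn {f : ℝ → ℝ} {s : Set ℝ} (hs : MeasurableSet s)
    (hs' : volume s ≠ ⊤) (hf : BoundedVariationOn f s) : IntegrableOn f s := by
  simpa using hf.integrableOn_mul hs hs' (measurable_const (a := (1 : ℝ))) (by simp)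

/-- A function of bounded variation deviates from its integral mean by at most its variation. -/
theorem BoundedVariationOn.abs_mul_volume_sub_integral_le {f : ℝ → ℝ} {s : Set ℝ}
    (hs : MeasurableSet s) (hs' : volume s ≠ ⊤) (hf : BoundedVariationOn f s) {x : ℝ}
    (hx : x ∈ s) : |f x * volume.real s - ∫ y in s, f y| ≤ realVariation f s * volume.real s := by
  have hI := hf.integrableOn hs hs'
  have e : f x * volume.real s - ∫ y in s, f y = ∫ y in s, (f x - f y) := by
    rw [integral_sub (integrableOn_const (C := f x) hs' (by simp)) hI, setIntegral_const, smul_eq_mul, mul_comm]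
  rw [e, ← Real.norm_eq_abs]
  exact norm_setIntegral_le_of_norm_le_const hs'.lt_top fun y hy => hf.abs_sub_le hx hy

theorem exists_monotone_enumeration (P : Finset ℝ) (h0 : (0 : ℝ) ∈ P) (h1 : (1 : ℝ) ∈ P)
    (hP : ∀ x ∈ P, x ∈ Icc (0 : ℝ) 1) :
    ∃ (N : ℕ) (a : ℕ → ℝ), Monotone a ∧ a 0 = 0 ∧ a N = 1 ∧ (∀ i < N, a i < a (i + 1)) ∧
      ∀ i < N, ∀ x ∈ P, x ∉ Ioo (a i) (a (i + 1)) := by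
  have hpos : 0 < P.card := Finset.card_pos.mpr ⟨0, h0⟩
  obtain ⟨N, hN⟩ : ∃ N, P.card = N + 1 := ⟨P.card - 1, by omega⟩
  set e := P.orderEmbOfFin hN with he
  set a : ℕ → ℝ := fun i => e ⟨min i N, by omega⟩ with ha
  have he0 : e ⟨0, by omega⟩ = 0 := by
    rw [he, Finset.orderEmbOfFin_zero hN (by omega)]
    exact le_antisymm (Finset.min'_le _ _ h0) (hP _ (Finset.min'_mem _ _)).1
  have heN : e ⟨N, by omega⟩ = 1 := by
    have := Finset.orderEmbOfFin_last hN (by omega)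
    rw [he]
    refine (this.trans ?_)
    exact le_antisymm (hP _ (Finset.max'_mem _ _)).2 (Finset.le_max' _ _ h1)
  refine ⟨N, a, ?_, ?_, ?_, ?_, ?_⟩
  · intro i j hij
    exact e.monotone (Fin.mk_le_mk.mpr (by omega))
  · simpa [ha] using he0
  · simpa [ha] using heN
  · intro i hi
    exact e.strictMono (Fin.mk_lt_mk.mpr (by omega))
  · intro i hi x hx hmem
    have : x ∈ Set.range e := by rw [he, Finset.range_orderEmbOfFin]; exact hx
    obtain ⟨j, rfl⟩ := this
    have h2 := e.lt_iff_lt.mp hmem.1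
    have h3 := e.lt_iff_lt.mp hmem.2
    rw [Fin.lt_def] at h2 h3
    simp only at h2 h3
    omega

theorem exists_fine_partition {S : Set ℝ} (hS : S.Finite) (L : ℝ) :
    ∃ (N : ℕ) (a : ℕ → ℝ), Monotone a ∧ a 0 = 0 ∧ a N = 1 ∧ (∀ i < N, a i < a (i + 1)) ∧
      (∀ i < N, Ioo (a i) (a (i + 1)) ⊆ Ioo (0 : ℝ) 1 \ S) ∧
      ∀ i < N, L * (a (i + 1) - a i) ≤ 1 := by
  classical
  obtain ⟨M, hM⟩ := exists_nat_ge (max L 1)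
  have hM1 : (1 : ℝ) ≤ M := (le_max_right _ _).trans hM
  have hML : L ≤ M := (le_max_left _ _).trans hM
  have hM0 : (0 : ℝ) < M := by linarith
  set P : Finset ℝ := hS.toFinset.filter (· ∈ Icc (0 : ℝ) 1) ∪
    (Finset.range (M + 1)).image (fun j : ℕ => (j : ℝ) / M)
  have hgrid : ∀ j : ℕ, j ≤ M → (j : ℝ) / M ∈ P := fun j hj =>
    Finset.mem_union_right _ (Finset.mem_image_of_mem _ (Finset.mem_range.mpr (by omega)))
  obtain ⟨N, a, ha, ha0, haN, hlt, hgap⟩ := exists_monotone_enumeration P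
    (by simpa using hgrid 0 (Nat.zero_le _))
    (by simpa [hM0.ne'] using hgrid M le_rfl) (by
      intro x hx
      rcases Finset.mem_union.mp hx with hx | hx
      · exact (Finset.mem_filter.mp hx).2
      · obtain ⟨j, hj, rfl⟩ := Finset.mem_image.mp hx
        have : (j : ℝ) ≤ M := by exact_mod_cast Nat.lt_succ_iff.mp (Finset.mem_range.mp hj)
        exact ⟨by positivity, (div_le_one hM0).mpr this⟩)
  have hrange : ∀ i ≤ N, a i ∈ Icc (0 : ℝ) 1 := fun i hi =>
    ⟨ha0 ▸ ha (Nat.zero_le i), haN ▸ ha hi⟩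
  refine ⟨N, a, ha, ha0, haN, hlt, ?_, ?_⟩
  · intro i hi x hx
    have hx01 : x ∈ Ioo (0 : ℝ) 1 :=
      ⟨(hrange i hi.le).1.trans_lt hx.1, hx.2.trans_le (hrange (i + 1) hi).2⟩
    refine ⟨hx01, fun hxS => hgap i hi x ?_ hx⟩
    exact Finset.mem_union_left _ (Finset.mem_filter.mpr
      ⟨hS.mem_toFinset.mpr hxS, hx01.1.le, hx01.2.le⟩)
  · intro i hi
    have hai := hrange i hi.le
    have hai' := hrange (i + 1) hi
    have hlen : (a (i + 1) - a i) * M ≤ 1 := by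
      by_contra! hcon
      have hf := Nat.lt_floor_add_one (a i * M)
      have hf' := Nat.floor_le (mul_nonneg hai.1 hM0.le)
      have hlt1 : ((⌊a i * M⌋₊ + 1 : ℕ) : ℝ) < M * a (i + 1) := by push_cast; linarith
      have hle : ⌊a i * M⌋₊ + 1 ≤ M := by
        have : ((⌊a i * M⌋₊ + 1 : ℕ) : ℝ) < M := hlt1.trans_le (by nlinarith [hai'.2])
        exact_mod_cast this.le
      refine hgap i hi _ (hgrid _ hle) ⟨?_, ?_⟩
      · rw [lt_div_iff₀ hM0]; push_cast; linarith
      · rw [div_lt_iff₀ hM0]; linarith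
    nlinarith [hlt i hi]

theorem sum_setIntegral_Ioo {a : ℕ → ℝ} (ha : Monotone a) {N : ℕ} (ha0 : a 0 = 0) (haN : a N = 1)
    {g : ℝ → ℝ} (hg : IntegrableOn g (Icc 0 1)) :
    ∑ i ∈ Finset.range N, ∫ x in Ioo (a i) (a (i + 1)), g x = ∫ x in Icc (0 : ℝ) 1, g x := by
  have hint : ∀ k < N, IntervalIntegrable g volume (a k) (a (k + 1)) := by
    intro k hk
    rw [intervalIntegrable_iff_integrableOn_Icc_of_le (ha k.le_succ)]
    refine hg.mono_set (Icc_subset_Icc ?_ ?_)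
    · rw [← ha0]; exact ha (Nat.zero_le _)
    · rw [← haN]; exact ha hk
  have := intervalIntegral.sum_integral_adjacent_intervals hint
  rw [ha0, haN, intervalIntegral.integral_of_le zero_le_one, ← integral_Icc_eq_integral_Ioc] at this
  rw [← this]
  refine Finset.sum_congr rfl fun i _ => ?_
  rw [intervalIntegral.integral_of_le (ha i.le_succ), integral_Ioc_eq_integral_Ioo]

/-- The part of the transfer operator coming from one monotone branch, with its variation bound. -/
theorem exists_branch_transfer {T f : ℝ → ℝ} {u v lam L : ℝ} (huv : u < v) (hlam : 8 ≤ lam)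
    (hL : 0 ≤ L) (hLl : L * (v - u) ≤ 1) (hmaps : MapsTo T (Ioo u v) (Icc 0 1))
    (hd : ∀ x ∈ Ioo u v, DifferentiableAt ℝ T x) (hlow : ∀ x ∈ Ioo u v, lam ≤ |deriv T x|)
    (hlip : ∀ x ∈ Ioo u v, ∀ y ∈ Ioo u v, |deriv T x - deriv T y| ≤ L * |x - y|)
    (hf : BoundedVariationOn f (Ioo u v)) :
    ∃ F : ℝ → ℝ, BoundedVariationOn F univ ∧
      realVariation F univ ≤ realVariation f (Ioo u v) / 2 +
        (v - u)⁻¹ * ∫ x in Ioo u v, |f x| ∧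
      ∀ ψ : ℝ → ℝ, ∫ y in Icc (0 : ℝ) 1, F y * ψ y = ∫ x in Ioo u v, f x * ψ (T x) := by
  have hlen : 0 < v - u := sub_pos.mpr huv
  have hlam0 : 0 < lam := by linarith
  have hdpos : ∀ x ∈ Ioo u v, 0 < |deriv T x| := fun x hx => hlam0.trans_le (hlow x hx)
  have hcont : ContinuousOn T (Ioo u v) := fun x hx => (hd x hx).continuousAt.continuousWithinAt
  have hinj : InjOn T (Ioo u v) := by
    have key : ∀ x ∈ Ioo u v, ∀ y ∈ Ioo u v, x < y → T x ≠ T y := by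
      intro x hx y hy hxy he
      have hsub : Icc x y ⊆ Ioo u v := Icc_subset_Ioo hx.1 hy.2
      obtain ⟨z, hz, hz0⟩ := exists_deriv_eq_zero hxy (hcont.mono hsub) he
      have := hdpos z (hsub (Ioo_subset_Icc_self hz))
      rw [hz0, abs_zero] at this
      exact lt_irrefl _ this
    intro x hx y hy hxy
    rcases lt_trichotomy x y with h | h | h
    · exact absurd hxy (key x hx y hy h)
    · exact h
    · exact absurd hxy.symm (key y hy x hx h)
  set B : ℝ := realVariation f (Ioo u v) + (v - u)⁻¹ * ∫ x in Ioo u v, |f x| with hB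
  have hI0 : 0 ≤ ∫ x in Ioo u v, |f x| := integral_nonneg fun x => abs_nonneg _
  have hV0 := realVariation_nonneg f (Ioo u v)
  have hB0 : 0 ≤ B := by positivity
  have hfB : ∀ x ∈ Ioo u v, |f x| ≤ B := by
    intro x hx
    have h1 := hf.abs_mul_volume_sub_integral_le measurableSet_Ioo (by simp) hx
    rw [Real.volume_real_Ioo_of_le huv.le] at h1
    have h2 : |∫ y in Ioo u v, f y| ≤ ∫ y in Ioo u v, |f y| := abs_integral_le_integral_abs
    have h3 := abs_sub_abs_le_abs_sub (f x * (v - u)) (∫ y in Ioo u v, f y)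
    rw [abs_mul, abs_of_pos hlen] at h3
    have h4 : |f x| * (v - u) ≤ B * (v - u) := by
      rw [hB, add_mul, mul_right_comm, inv_mul_cancel₀ hlen.ne', one_mul]
      linarith
    exact le_of_mul_le_mul_right h4 hlen
  set φ : ℝ → ℝ := fun x => f x / |deriv T x| with hφ
  have hφB : ∀ x ∈ Ioo u v, |φ x| ≤ B / 8 := by
    intro x hx
    rw [hφ, abs_div, abs_abs]
    exact div_le_div₀ hB0 (hfB x hx) (by norm_num) (hlam.trans (hlow x hx))
  have hφsub : ∀ x ∈ Ioo u v, ∀ y ∈ Ioo u v,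
      |φ x - φ y| ≤ 1 / 8 * |f x - f y| + B * L / 64 * |id x - id y| := by
    intro x hx y hy
    have hx0 := hdpos x hx
    have hy0 := hdpos y hy
    have hx8 : 8 ≤ |deriv T x| := hlam.trans (hlow x hx)
    have hy8 : 8 ≤ |deriv T y| := hlam.trans (hlow y hy)
    have e : φ x - φ y = (f x - f y) / |deriv T x| +
        f y * (|deriv T y| - |deriv T x|) / (|deriv T x| * |deriv T y|) := by
      simp only [hφ]
      field_simp
      ring
    rw [e]
    refine (abs_add_le _ _).trans (add_le_add ?_ ?_)
    · rw [abs_div, abs_abs, one_div, mul_comm, ← div_eq_mul_inv]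
      exact div_le_div_of_nonneg_left (abs_nonneg _) (by norm_num) hx8
    · rw [abs_div, abs_mul, abs_mul, abs_abs, abs_abs]
      have h1 : |(|deriv T y| - |deriv T x|)| ≤ L * |x - y| := by
        refine (abs_abs_sub_abs_le_abs_sub _ _).trans ?_
        rw [abs_sub_comm]
        exact hlip x hx y hy
      have h2 : |f y| * |(|deriv T y| - |deriv T x|)| ≤ B * (L * |x - y|) :=
        mul_le_mul (hfB y hy) h1 (abs_nonneg _) hB0
      have h3 : (64 : ℝ) ≤ |deriv T x| * |deriv T y| := by nlinarith
      have h4 : 0 ≤ B * (L * |x - y|) := by positivity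
      refine (div_le_div₀ h4 h2 (by norm_num) h3).trans_eq ?_
      simp only [id]
      ring
  have hid : BoundedVariationOn id (Ioo u v) ∧ realVariation id (Ioo u v) ≤ v - u :=
    boundedVariationOn_of_eVariationOn_le hlen.le
      ((eVariationOn.mono _ Ioo_subset_Icc_self).trans_eq (eVariationOn_id_Icc u v))
  obtain ⟨hφbv, hφV⟩ := BoundedVariationOn.of_abs_sub_le (by norm_num)
    (by positivity) hf hid.1 hφsub
  set s := T '' Ioo u v with hs
  set inv := Function.invFunOn T (Ioo u v) with hinv
  have hinv_mem : MapsTo inv s (Ioo u v) := fun y hy => Function.invFunOn_mem hy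
  have hT_inv : ∀ y ∈ s, T (inv y) = y := fun y hy => Function.invFunOn_eq hy
  have hinv_T : ∀ x ∈ Ioo u v, inv (T x) = x := fun x hx =>
    hinj (hinv_mem ⟨x, hx, rfl⟩) hx (hT_inv _ ⟨x, hx, rfl⟩)
  have hs_ord : s.OrdConnected := (isPreconnected_Ioo.image T hcont).ordConnected
  have hG : eVariationOn (φ ∘ inv) s ≤ eVariationOn φ (Ioo u v) := by
    rcases hcont.strictMonoOn_of_injOn_Ioo huv hinj with hm | hm
    · refine eVariationOn.comp_le_of_monotoneOn _ _ ?_ hinv_mem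
      intro y hy z hz hyz
      by_contra! hcon
      have := hm (hinv_mem hz) (hinv_mem hy) hcon
      rw [hT_inv y hy, hT_inv z hz] at this
      linarith
    · refine eVariationOn.comp_le_of_antitoneOn _ _ ?_ hinv_mem
      intro y hy z hz hyz
      by_contra! hcon
      have := hm (hinv_mem hy) (hinv_mem hz) hcon
      rw [hT_inv y hy, hT_inv z hz] at this
      linarith
  have hGbv : BoundedVariationOn (φ ∘ inv) s := ne_top_of_le_ne_top hφbv hG
  have hGV : realVariation (φ ∘ inv) s ≤ realVariation φ (Ioo u v) := ENNReal.toReal_mono hφbv hG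
  obtain ⟨hF, hFV⟩ := hGbv.indicator hs_ord (B := B / 8) (by positivity)
    fun y hy => hφB _ (hinv_mem hy)
  refine ⟨s.indicator (φ ∘ inv), hF, ?_, ?_⟩
  · have h1 : B * L / 64 * realVariation id (Ioo u v) ≤ B / 64 := by
      calc B * L / 64 * realVariation id (Ioo u v) ≤ B * L / 64 * (v - u) :=
            mul_le_mul_of_nonneg_left hid.2 (by positivity)
        _ = B / 64 * (L * (v - u)) := by ring
        _ ≤ B / 64 * 1 := mul_le_mul_of_nonneg_left hLl (by positivity)
        _ = B / 64 := mul_one _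
    have h2 : 0 ≤ (v - u)⁻¹ * ∫ x in Ioo u v, |f x| := by positivity
    linarith
  · intro ψ
    have hsm : MeasurableSet s := hs_ord.measurableSet
    have hs01 : s ⊆ Icc 0 1 := hmaps.image_subset
    have e1 : (fun y => s.indicator (φ ∘ inv) y * ψ y) =
        s.indicator (fun y => φ (inv y) * ψ y) := by
      ext y
      by_cases hy : y ∈ s <;> simp [hy]
    rw [e1, setIntegral_indicator hsm, inter_eq_right.mpr hs01,
      integral_image_eq_integral_abs_deriv_smul measurableSet_Ioo
        (fun x hx => (hd x hx).hasDerivAt.hasDerivWithinAt) hinj]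
    refine setIntegral_congr_fun measurableSet_Ioo fun x hx => ?_
    have := (hdpos x hx).ne'
    simp only [hinv_T x hx, hφ, smul_eq_mul]
    field_simp

/-- `P` is dual to composition with `T` on functions of bounded variation on `[0, 1]`, and
satisfies a Lasota–Yorke inequality with constants `1 / 2` and `K`. -/
def IsTransferOperator (T : ℝ → ℝ) (K : ℝ) (P : (ℝ → ℝ) → ℝ → ℝ) : Prop :=
  ∀ f, BoundedVariationOn f (Icc 0 1) →
    BoundedVariationOn (P f) (Icc 0 1) ∧
    realVariation (P f) (Icc 0 1) ≤
      realVariation f (Icc 0 1) / 2 + K * ∫ x in Icc (0 : ℝ) 1, |f x| ∧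
    ∀ ψ : ℝ → ℝ, Measurable ψ → (∀ x, |ψ x| ≤ 1) →
      ∫ y in Icc (0 : ℝ) 1, P f y * ψ y = ∫ x in Icc (0 : ℝ) 1, f x * ψ (T x)

/-- The transfer operator of `T` on functions of bounded variation, with the Lasota–Yorke
inequality. -/
theorem IsExpandingOff.exists_transfer {T : ℝ → ℝ} {S : Set ℝ} {lam Lam L : ℝ}
    (h : IsExpandingOff T S lam Lam L) (hlam : 8 ≤ lam) (hT : Measurable T)
    (hmaps : MapsTo T (Icc 0 1) (Icc 0 1)) :
    ∃ K, 0 ≤ K ∧ ∃ P, IsTransferOperator T K P := by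
  obtain ⟨N, a, ha, ha0, haN, hlt, hgap, hLl⟩ := exists_fine_partition h.finite L
  have hsub : ∀ i < N, Icc (a i) (a (i + 1)) ⊆ Icc 0 1 := fun i hi => by
    rw [← ha0, ← haN]
    exact Icc_subset_Icc (ha (Nat.zero_le _)) (ha hi)
  set K := ∑ i ∈ Finset.range N, (a (i + 1) - a i)⁻¹ with hK
  have hKi : ∀ i ∈ Finset.range N, 0 ≤ (a (i + 1) - a i)⁻¹ := fun i hi =>
    inv_nonneg.mpr (sub_nonneg.mpr (hlt i (Finset.mem_range.mp hi)).le)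
  refine ⟨K, Finset.sum_nonneg hKi, ?_⟩
  suffices hsuff : ∀ f, ∃ Pf : ℝ → ℝ, BoundedVariationOn f (Icc 0 1) →
      BoundedVariationOn Pf (Icc 0 1) ∧
      realVariation Pf (Icc 0 1) ≤
        realVariation f (Icc 0 1) / 2 + K * ∫ x in Icc (0 : ℝ) 1, |f x| ∧
      ∀ ψ : ℝ → ℝ, Measurable ψ → (∀ x, |ψ x| ≤ 1) →
        ∫ y in Icc (0 : ℝ) 1, Pf y * ψ y = ∫ x in Icc (0 : ℝ) 1, f x * ψ (T x) by
    choose P hP using hsuff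
    exact ⟨P, hP⟩
  intro f
  by_cases hf : BoundedVariationOn f (Icc 0 1)
  swap
  · exact ⟨f, fun h => absurd h hf⟩
  have hbranch : ∀ i ∈ Finset.range N, ∃ F : ℝ → ℝ, BoundedVariationOn F univ ∧
      realVariation F univ ≤ realVariation f (Ioo (a i) (a (i + 1))) / 2 +
        (a (i + 1) - a i)⁻¹ * ∫ x in Ioo (a i) (a (i + 1)), |f x| ∧
      ∀ ψ : ℝ → ℝ, ∫ y in Icc (0 : ℝ) 1, F y * ψ y =
        ∫ x in Ioo (a i) (a (i + 1)), f x * ψ (T x) := by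
    intro i hi
    have hi := Finset.mem_range.mp hi
    have hgi := hgap i hi
    refine exists_branch_transfer (hlt i hi) hlam h.L_nonneg (hLl i hi)
      (hmaps.mono_left (Ioo_subset_Icc_self.trans (hsub i hi)))
      (fun x hx => h.differentiableAt x (hgi hx)) (fun x hx => h.le_abs_deriv x (hgi hx)) ?_
      (hf.mono (Ioo_subset_Icc_self.trans (hsub i hi)))
    intro x hx y hy
    rcases le_total x y with hxy | hxy
    · exact h.lipschitz x y hxy ((Icc_subset_Ioo hx.1 hy.2).trans hgi)
    · rw [abs_sub_comm, abs_sub_comm x]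
      exact h.lipschitz y x hxy ((Icc_subset_Ioo hy.1 hx.2).trans hgi)
  choose! F hFbv hFV hFint using hbranch
  have hFbv' : ∀ i ∈ Finset.range N, BoundedVariationOn (F i) (Icc 0 1) := fun i hi =>
    (hFbv i hi).mono (subset_univ _)
  obtain ⟨hs, hsV⟩ := BoundedVariationOn.finset_sum (Finset.range N) hFbv'
  have habs : IntegrableOn (fun x => |f x|) (Icc 0 1) :=
    (hf.integrableOn measurableSet_Icc (by simp)).abs
  refine ⟨fun x => ∑ i ∈ Finset.range N, F i x, fun _ => ⟨hs, hsV.trans ?_, ?_⟩⟩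
  · have hsum : ∑ i ∈ Finset.range N, realVariation f (Icc (a i) (a (i + 1))) ≤
        realVariation f (Icc 0 1) := by
      have := BoundedVariationOn.sum_realVariation_le ha (n := N) (f := f) (by rwa [ha0, haN])
      rwa [ha0, haN] at this
    calc ∑ i ∈ Finset.range N, realVariation (F i) (Icc 0 1)
        ≤ ∑ i ∈ Finset.range N, (realVariation f (Icc (a i) (a (i + 1))) / 2 +
            (a (i + 1) - a i)⁻¹ * ∫ x in Icc (0 : ℝ) 1, |f x|) := by
          refine Finset.sum_le_sum fun i hi => ?_
          have hi' := Finset.mem_range.mp hi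
          refine ((hFbv i hi).realVariation_mono (subset_univ _)).trans ((hFV i hi).trans ?_)
          refine add_le_add ?_ (mul_le_mul_of_nonneg_left ?_ (hKi i hi))
          · exact div_le_div_of_nonneg_right
              ((hf.mono (hsub i hi')).realVariation_mono Ioo_subset_Icc_self) two_pos.le
          · exact setIntegral_mono_set habs (Filter.Eventually.of_forall fun x => abs_nonneg _)
              (Ioo_subset_Icc_self.trans (hsub i hi')).eventuallyLE
      _ = (∑ i ∈ Finset.range N, realVariation f (Icc (a i) (a (i + 1)))) / 2 +
            K * ∫ x in Icc (0 : ℝ) 1, |f x| := by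
          rw [Finset.sum_add_distrib, Finset.sum_div, hK, Finset.sum_mul]
      _ ≤ _ := by linarith
  · intro ψ hψ hψ1
    simp only [Finset.sum_mul]
    rw [integral_finsetSum _ fun i hi =>
      (hFbv' i hi).integrableOn_mul measurableSet_Icc (by simp) hψ hψ1]
    rw [← sum_setIntegral_Ioo ha ha0 haN
      (hf.integrableOn_mul (ψ := fun x => ψ (T x)) measurableSet_Icc (by simp) (hψ.comp hT)
        fun x => hψ1 _)]
    exact Finset.sum_congr rfl fun i hi => hFint i hi ψ

theorem volume_Icc_zero_one_ne_top : volume (Icc (0 : ℝ) 1) ≠ ⊤ := by simp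

theorem integral_abs_le_of_integral_eq_zero {f : ℝ → ℝ} (hf : BoundedVariationOn f (Icc 0 1))
    (hf0 : ∫ x in Icc (0 : ℝ) 1, f x = 0) :
    (∀ x ∈ Icc (0 : ℝ) 1, |f x| ≤ realVariation f (Icc 0 1)) ∧
      ∫ x in Icc (0 : ℝ) 1, |f x| ≤ realVariation f (Icc 0 1) := by
  have h1 : ∀ x ∈ Icc (0 : ℝ) 1, |f x| ≤ realVariation f (Icc 0 1) := by
    intro x hx
    have := hf.abs_mul_volume_sub_integral_le measurableSet_Icc volume_Icc_zero_one_ne_top hx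
    simpa [hf0] using this
  refine ⟨h1, ?_⟩
  have := norm_setIntegral_le_of_norm_le_const (μ := volume) (f := fun x => |f x|)
    volume_Icc_zero_one_ne_top.lt_top (fun x hx => by simpa using h1 x hx)
  simp only [Real.norm_eq_abs] at this
  simpa using (le_abs_self _).trans this

section Grid

variable {k : ℕ}

theorem grid_monotone (k : ℕ) : Monotone fun j : ℕ => (j : ℝ) / k := fun i j hij => by
  have : (i : ℝ) ≤ j := by exact_mod_cast hij
  exact div_le_div_of_nonneg_right this (Nat.cast_nonneg k)

theorem grid_zero (k : ℕ) : ((0 : ℕ) : ℝ) / k = 0 := by simp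

theorem grid_self (hk : 0 < k) : (k : ℝ) / k = 1 := div_self (by exact_mod_cast hk.ne')

theorem grid_sub (k j : ℕ) : ((j + 1 : ℕ) : ℝ) / k - (j : ℝ) / k = 1 / k := by
  push_cast; ring

theorem Icc_grid_subset (hk : 0 < k) {j : ℕ} (hj : j < k) :
    Icc ((j : ℝ) / k) (((j + 1 : ℕ) : ℝ) / k) ⊆ Icc 0 1 := by
  rw [← grid_zero k, ← grid_self hk]
  exact Icc_subset_Icc (grid_monotone k (Nat.zero_le j)) (grid_monotone k (Nat.succ_le_of_lt hj))

theorem BoundedVariationOn.sum_grid_le {f : ℝ → ℝ} (hf : BoundedVariationOn f (Icc 0 1))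
    (hk : 0 < k) :
    ∑ j ∈ Finset.range k, realVariation f (Icc ((j : ℝ) / k) (((j + 1 : ℕ) : ℝ) / k)) ≤
      realVariation f (Icc 0 1) := by
  have := BoundedVariationOn.sum_realVariation_le (grid_monotone k) (n := k) (f := f)
    (by simpa [grid_self hk] using hf)
  simpa only [grid_self hk, grid_zero] using this

theorem sum_grid_integral (hk : 0 < k) {g : ℝ → ℝ} (hg : IntegrableOn g (Icc 0 1)) :
    ∑ j ∈ Finset.range k, ∫ x in Ioo ((j : ℝ) / k) (((j + 1 : ℕ) : ℝ) / k), g x =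
      ∫ x in Icc (0 : ℝ) 1, g x :=
  sum_setIntegral_Ioo (grid_monotone k) (grid_zero k) (grid_self hk) hg

theorem volume_real_grid (k j : ℕ) :
    volume.real (Ioo ((j : ℝ) / k) (((j + 1 : ℕ) : ℝ) / k)) = 1 / k := by
  rw [Real.volume_real_Ioo_of_le (grid_monotone k j.le_succ), grid_sub]

/-- The `L¹` norm of a function of bounded variation is controlled by its averages over a grid. -/
theorem BoundedVariationOn.integral_abs_le_sum_grid {f : ℝ → ℝ}
    (hf : BoundedVariationOn f (Icc 0 1)) (hk : 0 < k) :
    ∫ x in Icc (0 : ℝ) 1, |f x| ≤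
      (∑ j ∈ Finset.range k, |∫ x in Ioo ((j : ℝ) / k) (((j + 1 : ℕ) : ℝ) / k), f x|) +
        realVariation f (Icc 0 1) / k := by
  have hk0 : (0 : ℝ) < k := by exact_mod_cast hk
  rw [← sum_grid_integral hk (hf.integrableOn measurableSet_Icc volume_Icc_zero_one_ne_top).abs]
  refine (Finset.sum_le_sum (g := fun j : ℕ =>
    |∫ x in Ioo ((j : ℝ) / k) (((j + 1 : ℕ) : ℝ) / k), f x| +
      realVariation f (Icc ((j : ℝ) / k) (((j + 1 : ℕ) : ℝ) / k)) / k) ?_).trans ?_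
  · intro j hj
    have hj := Finset.mem_range.mp hj
    have hfi := hf.mono (Icc_grid_subset hk hj)
    have hfo := hfi.mono Ioo_subset_Icc_self
    have hV := hfi.realVariation_mono Ioo_subset_Icc_self
    set J := Ioo ((j : ℝ) / k) (((j + 1 : ℕ) : ℝ) / k)
    have hvol : volume.real J = 1 / k := volume_real_grid k j
    have hpt : ∀ x ∈ J, |f x| ≤ k * |∫ x in J, f x| +
        realVariation f (Icc ((j : ℝ) / k) (((j + 1 : ℕ) : ℝ) / k)) := by
      intro x hx
      have h1 := hfo.abs_mul_volume_sub_integral_le measurableSet_Ioo (by simp) hx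
      have h3 := abs_sub_abs_le_abs_sub (f x * volume.real J) (∫ y in J, f y)
      rw [hvol, abs_mul, abs_of_pos (one_div_pos.mpr hk0)] at h3
      rw [hvol] at h1
      have h4 : |f x| * (1 / k) ≤ (k * |∫ x in J, f x| +
        realVariation f (Icc ((j : ℝ) / k) (((j + 1 : ℕ) : ℝ) / k))) * (1 / k) := by
        have e : (k * |∫ x in J, f x| +
          realVariation f (Icc ((j : ℝ) / k) (((j + 1 : ℕ) : ℝ) / k))) * (1 / k) =
          |∫ x in J, f x| +
            realVariation f (Icc ((j : ℝ) / k) (((j + 1 : ℕ) : ℝ) / k)) * (1 / k) := by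
          field_simp
        rw [e]
        have := mul_le_mul_of_nonneg_right hV (one_div_pos.mpr hk0).le
        linarith
      exact le_of_mul_le_mul_right h4 (one_div_pos.mpr hk0)
    have := norm_setIntegral_le_of_norm_le_const (μ := volume) (f := fun x => |f x|) (s := J)
      (by simp [J]) (fun x hx => (norm_abs_eq_norm (f x)).le.trans (hpt x hx))
    rw [hvol, Real.norm_eq_abs] at this
    refine (le_abs_self _).trans (this.trans_eq ?_)
    rw [mul_one_div, add_div, mul_div_cancel_left₀ _ hk0.ne']
  · rw [Finset.sum_add_distrib, ← Finset.sum_div]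
    gcongr
    exact hf.sum_grid_le hk

/-- Step-function approximation of a function of bounded variation against a bounded weight. -/
theorem BoundedVariationOn.abs_integral_sub_sum_grid_le {F g : ℝ → ℝ} {c : ℝ} (hc : 0 ≤ c)
    (hF : BoundedVariationOn F (Icc 0 1)) (hg : IntegrableOn g (Icc 0 1))
    (hFg : IntegrableOn (fun x => F x * g x) (Icc 0 1))
    (hgc : ∀ x ∈ Icc (0 : ℝ) 1, |g x| ≤ c) (hk : 0 < k) :
    |(∫ x in Icc (0 : ℝ) 1, F x * g x) - ∑ j ∈ Finset.range k,
      F ((j : ℝ) / k) * ∫ x in Ioo ((j : ℝ) / k) (((j + 1 : ℕ) : ℝ) / k), g x| ≤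
      c * realVariation F (Icc 0 1) / k := by
  rw [← sum_grid_integral hk hFg, ← Finset.sum_sub_distrib]
  refine (Finset.abs_sum_le_sum_abs _ _).trans ?_
  refine (Finset.sum_le_sum (g := fun j : ℕ =>
    c * realVariation F (Icc ((j : ℝ) / k) (((j + 1 : ℕ) : ℝ) / k)) / k) ?_).trans ?_
  · intro j hj
    have hj := Finset.mem_range.mp hj
    have hsub := Icc_grid_subset hk hj
    have hsub' := Ioo_subset_Icc_self.trans hsub
    have hFi := hF.mono hsub
    rw [← integral_const_mul, ← integral_sub (hFg.mono_set hsub')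
      ((hg.mono_set hsub').const_mul _)]
    have := norm_setIntegral_le_of_norm_le_const (μ := volume)
      (f := fun x => F x * g x - F ((j : ℝ) / k) * g x)
      (s := Ioo ((j : ℝ) / k) (((j + 1 : ℕ) : ℝ) / k))
      (C := c * realVariation F (Icc ((j : ℝ) / k) (((j + 1 : ℕ) : ℝ) / k))) (by simp) (by
        intro x hx
        rw [← sub_mul, norm_mul, mul_comm c]
        exact mul_le_mul (hFi.abs_sub_le (Ioo_subset_Icc_self hx)
          (left_mem_Icc.mpr (grid_monotone k j.le_succ))) (hgc x (hsub' hx)) (norm_nonneg _)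
          (realVariation_nonneg _ _))
    rw [volume_real_grid, mul_one_div] at this
    exact this
  · rw [← Finset.sum_div, ← Finset.mul_sum]
    gcongr
    exact hF.sum_grid_le hk

end Grid

/-- The measure of a set as an integral against the density. -/
theorem measureReal_eq_integral_density {μ : Measure ℝ} {h : ℝ → ℝ}
    (hdens : μ = (volume.restrict (Icc 0 1)).withDensity (fun x => ENNReal.ofReal (h x)))
    (hBV : BoundedVariationOn h (Icc 0 1)) (h0 : ∀ x ∈ Icc (0 : ℝ) 1, 0 ≤ h x)
    {A : Set ℝ} (hA : MeasurableSet A) :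
    μ.real A = ∫ x in Icc (0 : ℝ) 1, h x * A.indicator 1 x := by
  have hI := hBV.integrableOn measurableSet_Icc volume_Icc_zero_one_ne_top
  have e : (fun x => h x * A.indicator 1 x) = A.indicator h := by
    ext x; by_cases hx : x ∈ A <;> simp [hx]
  rw [e, setIntegral_indicator hA, Measure.real, hdens, withDensity_apply _ hA,
    Measure.restrict_restrict hA, inter_comm A,
    ← ofReal_integral_eq_lintegral_ofReal (hI.mono_set inter_subset_left),
    ENNReal.toReal_ofReal]
  · exact setIntegral_nonneg (measurableSet_Icc.inter hA) fun x hx => h0 x hx.1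
  · exact (ae_restrict_iff' (measurableSet_Icc.inter hA)).mpr
      (Filter.Eventually.of_forall fun x hx => h0 x hx.1)

/-- `μ` has a density on `[0,1]` which is of bounded variation and takes values in `[c⁻¹, c]`. -/
structure HasBVDensity (μ : Measure ℝ) (h : ℝ → ℝ) (c : ℝ) : Prop where
  one_le : 1 ≤ c
  eq_withDensity : μ = (volume.restrict (Icc 0 1)).withDensity (fun x => ENNReal.ofReal (h x))
  bv : BoundedVariationOn h (Icc 0 1)
  bounds : ∀ x ∈ Icc (0 : ℝ) 1, c⁻¹ ≤ h x ∧ h x ≤ c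

namespace HasBVDensity

variable {μ : Measure ℝ} {h : ℝ → ℝ} {c : ℝ}

theorem pos (hμ : HasBVDensity μ h c) {x : ℝ} (hx : x ∈ Icc (0 : ℝ) 1) : 0 < h x :=
  (inv_pos.mpr (zero_lt_one.trans_le hμ.one_le)).trans_le (hμ.bounds x hx).1

theorem measureReal_eq_integral (hμ : HasBVDensity μ h c) {A : Set ℝ} (hA : MeasurableSet A) :
    μ.real A = ∫ x in Icc (0 : ℝ) 1, h x * A.indicator 1 x :=
  measureReal_eq_integral_density hμ.eq_withDensity hμ.bv (fun _ hx => (hμ.pos hx).le) hA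

theorem measureReal_inter_eq_integral (hμ : HasBVDensity μ h c) {J A : Set ℝ}
    (hJ : MeasurableSet J) (hJ1 : J ⊆ Icc 0 1) (hA : MeasurableSet A) :
    μ.real (J ∩ A) = ∫ x in J, h x * A.indicator 1 x := by
  have e : (fun x => h x * (J ∩ A).indicator 1 x) =
      J.indicator (fun x => h x * A.indicator 1 x) := by
    ext x; by_cases hx : x ∈ J <;> by_cases hx' : x ∈ A <;> simp [hx, hx']
  rw [hμ.measureReal_eq_integral (hJ.inter hA), e, setIntegral_indicator hJ,
    inter_eq_self_of_subset_right hJ1]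

theorem inv_abs_le (hμ : HasBVDensity μ h c) {x : ℝ} (hx : x ∈ Icc (0 : ℝ) 1) :
    |(h x)⁻¹| ≤ c := by
  rw [abs_of_pos (inv_pos.mpr (hμ.pos hx))]
  exact inv_le_of_inv_le₀ (zero_lt_one.trans_le hμ.one_le) (hμ.bounds x hx).1

/-- The quotient of a mean-zero function by the density is of bounded variation. -/
theorem div_density (hμ : HasBVDensity μ h c) {f : ℝ → ℝ} (hf : BoundedVariationOn f (Icc 0 1))
    (hf0 : ∫ x in Icc (0 : ℝ) 1, f x = 0) :
    BoundedVariationOn (fun x => f x * (h x)⁻¹) (Icc 0 1) ∧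
      realVariation (fun x => f x * (h x)⁻¹) (Icc 0 1) ≤
        (c + c ^ 2 * realVariation h (Icc 0 1)) * realVariation f (Icc 0 1) := by
  have hc0 := zero_lt_one.trans_le hμ.one_le
  have hV := realVariation_nonneg f (Icc (0 : ℝ) 1)
  have := BoundedVariationOn.of_abs_sub_le (F := fun x => f x * (h x)⁻¹) hc0.le
    (mul_nonneg (sq_nonneg c) hV) hf hμ.bv ?_
  · refine ⟨this.1, this.2.trans_eq ?_⟩
    ring
  · intro x hx y hy
    have hx0 := hμ.pos hx
    have hy0 := hμ.pos hy
    have e : f x * (h x)⁻¹ - f y * (h y)⁻¹ =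
        (h x)⁻¹ * (f x - f y) + ((h x)⁻¹ * (h y)⁻¹ * f y) * (h y - h x) := by
      field_simp
      ring
    rw [e]
    refine (abs_add_le _ _).trans (add_le_add ?_ ?_)
    · rw [abs_mul]
      exact mul_le_mul_of_nonneg_right (hμ.inv_abs_le hx) (abs_nonneg _)
    · rw [abs_mul, abs_mul, abs_mul, abs_sub_comm (h y), sq]
      refine mul_le_mul_of_nonneg_right ?_ (abs_nonneg _)
      have h1 := (integral_abs_le_of_integral_eq_zero hf hf0).1 y hy
      have h2 := hμ.inv_abs_le hx
      have h3 := hμ.inv_abs_le hy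
      gcongr

theorem tendsto_measureReal [IsProbabilityMeasure μ] {T : ℝ → ℝ} (hmix : Mixing T μ)
    {A B : Set ℝ} (hA : MeasurableSet A) (hB : MeasurableSet B) :
    Filter.Tendsto (fun n => μ.real (A ∩ T^[n] ⁻¹' B)) Filter.atTop
      (nhds (μ.real A * μ.real B)) := by
  have := (ENNReal.tendsto_toReal (ENNReal.mul_ne_top (measure_ne_top μ A)
    (measure_ne_top μ B))).comp (hmix A B hA hB)
  simpa [ENNReal.toReal_mul, Measure.real, Function.comp_def] using this

/-- Mixing holds uniformly over mean-zero observables of bounded variation. -/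
theorem eventually_abs_integral_le [IsProbabilityMeasure μ] (hμ : HasBVDensity μ h c)
    {T : ℝ → ℝ} (hT : Measurable T) (hmix : Mixing T μ) {B : Set ℝ} (hB : MeasurableSet B)
    {ε : ℝ} (hε : 0 < ε) :
    ∀ᶠ n in Filter.atTop, ∀ f : ℝ → ℝ, BoundedVariationOn f (Icc 0 1) →
      ∫ x in Icc (0 : ℝ) 1, f x = 0 →
        |∫ x in Icc (0 : ℝ) 1, f x * B.indicator 1 (T^[n] x)| ≤
          ε * realVariation f (Icc 0 1) := by
  have hc0 := zero_lt_one.trans_le hμ.one_le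
  set D := c + c ^ 2 * realVariation h (Icc 0 1) with hD
  obtain ⟨k, hk⟩ := exists_nat_gt (c * D / (ε / 2))
  have hDp : 0 < D := by
    have := mul_nonneg (sq_nonneg c) (realVariation_nonneg h (Icc 0 1))
    linarith
  have hk0 : (0 : ℝ) < k := lt_trans (by positivity) hk
  have hk1 : 0 < k := by exact_mod_cast hk0
  have hkD : c * D / k ≤ ε / 2 := by
    rw [div_lt_iff₀ (by positivity)] at hk
    rw [div_le_iff₀ hk0]; linarith
  have hlim : Filter.Tendsto (fun n => ∑ j ∈ Finset.range k,
      c * |μ.real (Ioo ((j : ℝ) / k) (((j + 1 : ℕ) : ℝ) / k) ∩ T^[n] ⁻¹' B) -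
        μ.real (Ioo ((j : ℝ) / k) (((j + 1 : ℕ) : ℝ) / k)) * μ.real B|)
      Filter.atTop (nhds 0) := by
    rw [show (0 : ℝ) = ∑ j ∈ Finset.range k, c * |(0 : ℝ)| by simp]
    refine tendsto_finsetSum _ fun j _ => Filter.Tendsto.const_mul _ (Filter.Tendsto.abs ?_)
    exact tendsto_sub_nhds_zero_iff.mpr
      (tendsto_measureReal hmix measurableSet_Ioo hB)
  filter_upwards [hlim.eventually (gt_mem_nhds (half_pos hε))] with n hn f hf hf0
  have hV := realVariation_nonneg f (Icc (0 : ℝ) 1)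
  have hTn : MeasurableSet (T^[n] ⁻¹' B) := (hT.iterate n) hB
  obtain ⟨hF, hFV⟩ := hμ.div_density hf hf0
  set A := T^[n] ⁻¹' B with hA
  have hind : ∀ x, B.indicator (1 : ℝ → ℝ) (T^[n] x) = A.indicator 1 x := fun x => by
    by_cases hx : T^[n] x ∈ B <;> simp [hA, hx]
  simp only [hind]
  have hμB : 0 ≤ μ.real B ∧ μ.real B ≤ 1 := ⟨measureReal_nonneg, measureReal_le_one⟩
  have hψ : Measurable fun x => A.indicator (1 : ℝ → ℝ) x - μ.real B :=
    (measurable_one.indicator hTn).sub_const _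
  have hψ1 : ∀ x, |A.indicator (1 : ℝ → ℝ) x - μ.real B| ≤ 1 := fun x => by
    by_cases hx : x ∈ A <;> simp [hx, abs_le] <;> linarith [hμB.1, hμB.2]
  have hg := hμ.bv.integrableOn_mul measurableSet_Icc volume_Icc_zero_one_ne_top hψ hψ1
  have hfψ := hf.integrableOn_mul measurableSet_Icc volume_Icc_zero_one_ne_top hψ hψ1
  have hFg : EqOn (fun x => f x * (A.indicator (1 : ℝ → ℝ) x - μ.real B))
      (fun x => f x * (h x)⁻¹ * (h x * (A.indicator (1 : ℝ → ℝ) x - μ.real B)))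
      (Icc 0 1) := fun x hx => by
    have := (hμ.pos hx).ne'
    simp only
    field_simp
  have key := hF.abs_integral_sub_sum_grid_le hc0.le hg
    (hfψ.congr_fun hFg measurableSet_Icc) (fun x hx => by
      rw [abs_mul, abs_of_pos (hμ.pos hx)]
      exact (mul_le_mul (hμ.bounds x hx).2 (hψ1 x) (abs_nonneg _) hc0.le).trans_eq
        (mul_one c)) hk1
  rw [← setIntegral_congr_fun measurableSet_Icc hFg] at key
  have hfi := hf.integrableOn measurableSet_Icc volume_Icc_zero_one_ne_top
  have e1 : ∫ x in Icc (0 : ℝ) 1, f x * (A.indicator (1 : ℝ → ℝ) x - μ.real B) =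
      ∫ x in Icc (0 : ℝ) 1, f x * A.indicator (1 : ℝ → ℝ) x := by
    simp only [mul_sub]
    rw [integral_sub _ (hfi.mul_const _), integral_mul_const, hf0, zero_mul, sub_zero]
    exact hf.integrableOn_mul measurableSet_Icc volume_Icc_zero_one_ne_top
      (measurable_one.indicator hTn) fun x => by by_cases hx : x ∈ A <;> simp [hx]
  rw [e1] at key
  have hsum : |∑ j ∈ Finset.range k, f ((j : ℝ) / k) * (h ((j : ℝ) / k))⁻¹ *
      ∫ x in Ioo ((j : ℝ) / k) (((j + 1 : ℕ) : ℝ) / k),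
        h x * (A.indicator (1 : ℝ → ℝ) x - μ.real B)| ≤
      (ε / 2) * realVariation f (Icc 0 1) := by
    refine (Finset.abs_sum_le_sum_abs _ _).trans
      (le_trans ?_ (mul_le_mul_of_nonneg_right hn.le hV))
    rw [Finset.sum_mul]
    refine Finset.sum_le_sum fun j hj => ?_
    have hsub := Icc_grid_subset hk1 (Finset.mem_range.mp hj)
    have hsub' := Ioo_subset_Icc_self.trans hsub
    have hmem := hsub (left_mem_Icc.mpr (grid_monotone k j.le_succ))
    have hint : ∫ x in Ioo ((j : ℝ) / k) (((j + 1 : ℕ) : ℝ) / k),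
        h x * (A.indicator (1 : ℝ → ℝ) x - μ.real B) =
        μ.real (Ioo ((j : ℝ) / k) (((j + 1 : ℕ) : ℝ) / k) ∩ A) -
        μ.real (Ioo ((j : ℝ) / k) (((j + 1 : ℕ) : ℝ) / k)) * μ.real B := by
      have hhi := hμ.bv.integrableOn measurableSet_Icc volume_Icc_zero_one_ne_top
      have h1 := hμ.measureReal_inter_eq_integral measurableSet_Ioo hsub' hTn
      have h2 := hμ.measureReal_inter_eq_integral measurableSet_Ioo hsub' MeasurableSet.univ
      rw [inter_univ] at h2
      rw [h1, h2]
      simp only [mul_sub, indicator_univ, Pi.one_apply, mul_one]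
      rw [integral_sub _ ((hhi.mono_set hsub').mul_const _), integral_mul_const]
      exact (hμ.bv.integrableOn_mul measurableSet_Icc volume_Icc_zero_one_ne_top
        (measurable_one.indicator hTn)
        fun x => by by_cases hx : x ∈ A <;> simp [hx]).mono_set hsub'
    rw [hint, abs_mul, abs_mul]
    have h1 := (integral_abs_le_of_integral_eq_zero hf hf0).1 _ hmem
    have h2 := hμ.inv_abs_le hmem
    calc _ ≤ (realVariation f (Icc 0 1) * c) * _ := by gcongr
      _ = _ := by ring
  have h1 : c * realVariation (fun x => f x * (h x)⁻¹) (Icc 0 1) / k ≤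
      (ε / 2) * realVariation f (Icc 0 1) := by
    calc _ ≤ c * (D * realVariation f (Icc 0 1)) / k := by gcongr
      _ = (c * D / k) * realVariation f (Icc 0 1) := by ring
      _ ≤ _ := mul_le_mul_of_nonneg_right hkD hV
  have h2 := abs_le.mp hsum
  have h3 := abs_le.mp (key.trans h1)
  exact abs_le.mpr ⟨by linarith, by linarith⟩

end HasBVDensity

theorem abs_indicator_one_le (A : Set ℝ) (x : ℝ) : |A.indicator (1 : ℝ → ℝ) x| ≤ 1 := by
  by_cases hx : x ∈ A <;> simp [hx]

theorem BoundedVariationOn.exists_integral_abs_eq {g : ℝ → ℝ}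
    (hg : BoundedVariationOn g (Icc 0 1)) :
    ∃ ψ : ℝ → ℝ, Measurable ψ ∧ (∀ x, |ψ x| ≤ 1) ∧
      ∫ x in Icc (0 : ℝ) 1, |g x| = ∫ x in Icc (0 : ℝ) 1, g x * ψ x := by
  have hm := hg.aemeasurable measurableSet_Icc
  refine ⟨fun x => if 0 ≤ hm.mk g x then 1 else -1, ?_, ?_, ?_⟩
  · exact Measurable.ite (measurableSet_le measurable_const hm.measurable_mk)
      measurable_const measurable_const
  · intro x
    by_cases hx : 0 ≤ hm.mk g x <;> simp [hx]
  · refine integral_congr_ae ?_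
    filter_upwards [hm.ae_eq_mk] with x hx
    simp only [← hx]
    by_cases h0 : 0 ≤ g x
    · simp [h0, abs_of_nonneg]
    · simp [h0, abs_of_neg (not_le.mp h0)]

theorem BoundedVariationOn.abs_integral_mul_le {f ψ : ℝ → ℝ} (hf : BoundedVariationOn f (Icc 0 1))
    (hψ1 : ∀ x, |ψ x| ≤ 1) :
    |∫ x in Icc (0 : ℝ) 1, f x * ψ x| ≤ ∫ x in Icc (0 : ℝ) 1, |f x| := by
  refine norm_integral_le_of_norm_le (f := fun x => f x * ψ x) (g := fun x => |f x|)
    (hf.integrableOn measurableSet_Icc volume_Icc_zero_one_ne_top).abs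
    (Filter.Eventually.of_forall fun x => ?_)
  rw [norm_mul]
  exact mul_le_of_le_one_right (abs_nonneg _) (hψ1 x)

namespace IsTransferOperator

variable {T : ℝ → ℝ} {K : ℝ} {P : (ℝ → ℝ) → ℝ → ℝ}

theorem iterate_bv (hP : IsTransferOperator T K P) {f : ℝ → ℝ}
    (hf : BoundedVariationOn f (Icc 0 1)) (n : ℕ) : BoundedVariationOn (P^[n] f) (Icc 0 1) := by
  induction n with
  | zero => exact hf
  | succ n ih => rw [Function.iterate_succ_apply']; exact (hP _ ih).1

theorem integral_iterate_mul (hP : IsTransferOperator T K P) (hT : Measurable T) {f : ℝ → ℝ}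
    (hf : BoundedVariationOn f (Icc 0 1)) (n : ℕ) {ψ : ℝ → ℝ} (hψ : Measurable ψ)
    (hψ1 : ∀ x, |ψ x| ≤ 1) :
    ∫ x in Icc (0 : ℝ) 1, P^[n] f x * ψ x = ∫ x in Icc (0 : ℝ) 1, f x * ψ (T^[n] x) := by
  induction n generalizing ψ with
  | zero => rfl
  | succ n ih =>
    simp only [Function.iterate_succ_apply' T]
    rw [Function.iterate_succ_apply', (hP _ (hP.iterate_bv hf n)).2.2 ψ hψ hψ1]
    exact ih (hψ.comp hT) fun x => hψ1 _

theorem integral_iterate_eq_zero (hP : IsTransferOperator T K P) (hT : Measurable T) {f : ℝ → ℝ}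
    (hf : BoundedVariationOn f (Icc 0 1)) (hf0 : ∫ x in Icc (0 : ℝ) 1, f x = 0) (n : ℕ) :
    ∫ x in Icc (0 : ℝ) 1, P^[n] f x = 0 := by
  have := hP.integral_iterate_mul hT hf n (measurable_const (a := (1 : ℝ))) (by simp)
  simpa [hf0] using this

theorem integral_abs_iterate_le (hP : IsTransferOperator T K P) (hT : Measurable T) {f : ℝ → ℝ}
    (hf : BoundedVariationOn f (Icc 0 1)) (n : ℕ) :
    ∫ x in Icc (0 : ℝ) 1, |P^[n] f x| ≤ ∫ x in Icc (0 : ℝ) 1, |f x| := by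
  obtain ⟨ψ, hψ, hψ1, e⟩ := (hP.iterate_bv hf n).exists_integral_abs_eq
  rw [e, hP.integral_iterate_mul hT hf n hψ hψ1]
  exact (le_abs_self _).trans (hf.abs_integral_mul_le fun x => hψ1 _)

/-- The iterated Lasota–Yorke inequality. -/
theorem realVariation_iterate_le (hP : IsTransferOperator T K P) (hK : 0 ≤ K) (hT : Measurable T)
    {f : ℝ → ℝ} (hf : BoundedVariationOn f (Icc 0 1)) (n : ℕ) :
    realVariation (P^[n] f) (Icc 0 1) ≤
      realVariation f (Icc 0 1) / 2 ^ n + 2 * K * ∫ x in Icc (0 : ℝ) 1, |f x| := by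
  induction n with
  | zero =>
    have : 0 ≤ ∫ x in Icc (0 : ℝ) 1, |f x| := integral_nonneg fun x => abs_nonneg _
    simp only [Function.iterate_zero, id, pow_zero, div_one]
    have := mul_nonneg hK this
    linarith
  | succ n ih =>
    rw [Function.iterate_succ_apply']
    have h1 := (hP _ (hP.iterate_bv hf n)).2.1
    have h2 := mul_le_mul_of_nonneg_left (hP.integral_abs_iterate_le hT hf n) hK
    have e : realVariation f (Icc 0 1) / 2 ^ (n + 1) =
        realVariation f (Icc 0 1) / 2 ^ n / 2 := by
      rw [pow_succ, div_div]
    rw [e]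
    linarith

theorem realVariation_iterate_le_of_integral_eq_zero (hP : IsTransferOperator T K P) (hK : 0 ≤ K)
    (hT : Measurable T) {f : ℝ → ℝ} (hf : BoundedVariationOn f (Icc 0 1))
    (hf0 : ∫ x in Icc (0 : ℝ) 1, f x = 0) (n : ℕ) :
    realVariation (P^[n] f) (Icc 0 1) ≤ (1 + 2 * K) * realVariation f (Icc 0 1) := by
  have h1 := hP.realVariation_iterate_le hK hT hf n
  have h2 := mul_le_mul_of_nonneg_left (integral_abs_le_of_integral_eq_zero hf hf0).2 hK
  have h3 : realVariation f (Icc 0 1) / 2 ^ n ≤ realVariation f (Icc 0 1) :=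
    div_le_self (realVariation_nonneg _ _) (one_le_pow₀ one_le_two)
  linarith

variable {μ : Measure ℝ} [IsProbabilityMeasure μ] {h : ℝ → ℝ} {c : ℝ}

/-- The transfer operator of a mixing map is eventually small from mean-zero functions of bounded
variation to `L¹`. -/
theorem exists_integral_abs_iterate_le (hP : IsTransferOperator T K P) (hK : 0 ≤ K)
    (hT : Measurable T) (hμ : HasBVDensity μ h c) (hmix : Mixing T μ) {ε : ℝ} (hε : 0 < ε) :
    ∃ n, ∀ f : ℝ → ℝ, BoundedVariationOn f (Icc 0 1) → ∫ x in Icc (0 : ℝ) 1, f x = 0 →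
      ∫ x in Icc (0 : ℝ) 1, |P^[n] f x| ≤ ε * realVariation f (Icc 0 1) := by
  obtain ⟨k, hk⟩ := exists_nat_gt ((1 + 2 * K) / (ε / 2))
  have hk0 : (0 : ℝ) < k := lt_trans (by positivity) hk
  have hk1 : 0 < k := by exact_mod_cast hk0
  have hkK : (1 + 2 * K) / k ≤ ε / 2 := by
    rw [div_lt_iff₀ (by positivity)] at hk
    rw [div_le_iff₀ hk0]; linarith
  have hev : ∀ᶠ n in Filter.atTop, ∀ j ∈ Finset.range k, ∀ f : ℝ → ℝ,
      BoundedVariationOn f (Icc 0 1) → ∫ x in Icc (0 : ℝ) 1, f x = 0 →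
        |∫ x in Icc (0 : ℝ) 1, f x *
          (Ioo ((j : ℝ) / k) (((j + 1 : ℕ) : ℝ) / k)).indicator 1 (T^[n] x)| ≤
          (ε / (2 * k)) * realVariation f (Icc 0 1) :=
    (Filter.eventually_all_finset _).mpr fun j _ =>
      hμ.eventually_abs_integral_le hT hmix measurableSet_Ioo (by positivity)
  obtain ⟨n, hn⟩ := hev.exists
  refine ⟨n, fun f hf hf0 => ?_⟩
  have hV := realVariation_nonneg f (Icc (0 : ℝ) 1)
  refine ((hP.iterate_bv hf n).integral_abs_le_sum_grid hk1).trans ?_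
  have h1 : ∑ j ∈ Finset.range k,
      |∫ x in Ioo ((j : ℝ) / k) (((j + 1 : ℕ) : ℝ) / k), P^[n] f x| ≤
      (ε / 2) * realVariation f (Icc 0 1) := by
    refine (Finset.sum_le_card_nsmul _ _ ((ε / (2 * k)) * realVariation f (Icc 0 1))
      fun j hj => ?_).trans_eq ?_
    · have hsub : Ioo ((j : ℝ) / k) (((j + 1 : ℕ) : ℝ) / k) ⊆ Icc 0 1 :=
        Ioo_subset_Icc_self.trans (Icc_grid_subset hk1 (Finset.mem_range.mp hj))
      set J := Ioo ((j : ℝ) / k) (((j + 1 : ℕ) : ℝ) / k)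
      have e : ∫ x in J, P^[n] f x = ∫ x in Icc (0 : ℝ) 1, f x * J.indicator 1 (T^[n] x) := by
        rw [← hP.integral_iterate_mul hT hf n (measurable_one.indicator measurableSet_Ioo)
          (abs_indicator_one_le J)]
        have : (fun x => P^[n] f x * J.indicator 1 x) = J.indicator (P^[n] f) := by
          ext x; by_cases hx : x ∈ J <;> simp [hx]
        rw [this, setIntegral_indicator measurableSet_Ioo, inter_eq_self_of_subset_right hsub]
      rw [e]
      exact hn j hj f hf hf0
    · rw [Finset.card_range, nsmul_eq_mul]
      field_simp
  have h2 : realVariation (P^[n] f) (Icc 0 1) / k ≤ (ε / 2) * realVariation f (Icc 0 1) := by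
    calc _ ≤ (1 + 2 * K) * realVariation f (Icc 0 1) / k := by
          have := hP.realVariation_iterate_le_of_integral_eq_zero hK hT hf hf0 n
          gcongr
      _ = (1 + 2 * K) / k * realVariation f (Icc 0 1) := by ring
      _ ≤ _ := mul_le_mul_of_nonneg_right hkK hV
  linarith

theorem exists_realVariation_iterate_le_half (hP : IsTransferOperator T K P) (hK : 0 ≤ K)
    (hT : Measurable T) (hμ : HasBVDensity μ h c) (hmix : Mixing T μ) :
    ∃ n, 0 < n ∧ ∀ f : ℝ → ℝ, BoundedVariationOn f (Icc 0 1) → ∫ x in Icc (0 : ℝ) 1, f x = 0 →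
      realVariation (P^[n] f) (Icc 0 1) ≤ realVariation f (Icc 0 1) / 2 := by
  obtain ⟨j, hj⟩ := pow_unbounded_of_one_lt (4 * (1 + 2 * K)) (one_lt_two (α := ℝ))
  obtain ⟨n, hn⟩ := hP.exists_integral_abs_iterate_le hK hT hμ hmix
    (ε := 1 / (4 * (1 + 2 * K))) (by positivity)
  refine ⟨j + 1 + n, by omega, fun f hf hf0 => ?_⟩
  have hV := realVariation_nonneg f (Icc (0 : ℝ) 1)
  rw [Function.iterate_add_apply]
  have h1 := hP.realVariation_iterate_le hK hT (hP.iterate_bv hf n) (j + 1)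
  have h2 := hP.realVariation_iterate_le_of_integral_eq_zero hK hT hf hf0 n
  have h3 : realVariation (P^[n] f) (Icc 0 1) / 2 ^ (j + 1) ≤
      realVariation f (Icc 0 1) / 4 := by
    rw [div_le_iff₀ (by positivity), pow_succ]
    have := mul_le_mul_of_nonneg_right hj.le hV
    nlinarith
  have h4 : 2 * K * ∫ x in Icc (0 : ℝ) 1, |P^[n] f x| ≤ realVariation f (Icc 0 1) / 4 := by
    calc _ ≤ (1 + 2 * K) * (1 / (4 * (1 + 2 * K)) * realVariation f (Icc 0 1)) :=
          mul_le_mul (by linarith) (hn f hf hf0) (integral_nonneg fun x => abs_nonneg _)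
            (by positivity)
      _ = _ := by field_simp
  linarith

/-- Exponential decay of correlations along a subsequence of times. -/
theorem exists_abs_integral_comp_le (hP : IsTransferOperator T K P) (hK : 0 ≤ K)
    (hT : Measurable T) (hμ : HasBVDensity μ h c) (hmix : Mixing T μ) :
    ∃ n, 0 < n ∧ ∀ (q : ℕ) (f ψ : ℝ → ℝ), BoundedVariationOn f (Icc 0 1) →
      ∫ x in Icc (0 : ℝ) 1, f x = 0 → Measurable ψ → (∀ x, |ψ x| ≤ 1) →
        |∫ x in Icc (0 : ℝ) 1, f x * ψ (T^[n * q] x)| ≤ realVariation f (Icc 0 1) / 2 ^ q := by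
  obtain ⟨n, hn0, hn⟩ := hP.exists_realVariation_iterate_le_half hK hT hμ hmix
  refine ⟨n, hn0, fun q f ψ hf hf0 hψ hψ1 => ?_⟩
  have hq : realVariation (P^[n * q] f) (Icc 0 1) ≤ realVariation f (Icc 0 1) / 2 ^ q := by
    induction q with
    | zero => simp
    | succ q ih =>
      rw [Nat.mul_succ, add_comm, Function.iterate_add_apply, pow_succ, ← div_div]
      have := hn _ (hP.iterate_bv hf (n * q)) (hP.integral_iterate_eq_zero hT hf hf0 _)
      linarith
  rw [← hP.integral_iterate_mul hT hf _ hψ hψ1]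
  exact (((hP.iterate_bv hf _).abs_integral_mul_le hψ1).trans
    (integral_abs_le_of_integral_eq_zero (hP.iterate_bv hf _)
      (hP.integral_iterate_eq_zero hT hf hf0 _)).2).trans hq

end IsTransferOperator

theorem Mixing.iterate {T : ℝ → ℝ} {μ : Measure ℝ} (hmix : Mixing T μ) {N : ℕ} (hN : 0 < N) :
    Mixing T^[N] μ := fun A B hA hB => by
  have h1 : Filter.Tendsto (fun n => N * n) Filter.atTop Filter.atTop :=
    Filter.tendsto_id.const_mul_atTop' hN
  simpa only [Function.iterate_mul, Function.comp_def] using (hmix A B hA hB).comp h1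

theorem inv_two_pow_div_le_exp {M : ℕ} (hM : 0 < M) (n : ℕ) :
    1 / (2 : ℝ) ^ (n / M) ≤ 2 * Real.exp (-(Real.log 2 / M) * n) := by
  have hM' : (0 : ℝ) < M := by exact_mod_cast hM
  have hl := Real.log_pos (one_lt_two (α := ℝ))
  have h1 : (n : ℝ) / M ≤ (n / M : ℕ) + 1 := by
    rw [div_le_iff₀ hM']
    have : n ≤ (n / M + 1) * M := by
      have h2 := Nat.div_add_mod n M
      have h3 := Nat.mod_lt n hM
      nlinarith
    exact_mod_cast this
  have h2 : Real.exp (-(Real.log 2 * ((n / M : ℕ) + 1))) ≤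
      Real.exp (-(Real.log 2 / M) * n) := by
    apply Real.exp_le_exp.mpr
    have := mul_le_mul_of_nonneg_left h1 hl.le
    have e : -(Real.log 2 / M) * n = -(Real.log 2 * (n / M)) := by ring
    rw [e]; linarith
  have h3 : Real.exp (-(Real.log 2 * ((n / M : ℕ) + 1))) = 1 / (2 : ℝ) ^ (n / M) / 2 := by
    have h4 : (Real.log 2 * ((n / M : ℕ) + 1)) = Real.log ((2 : ℝ) ^ (n / M + 1)) := by
      rw [Real.log_pow]; push_cast; ring
    rw [h4, Real.exp_neg, Real.exp_log (by positivity), pow_succ, mul_inv, one_div, div_eq_mul_inv]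
  linarith

/-- Exponential decay of correlations for functions of bounded variation. -/
theorem IsPiecewiseC2Expanding.exists_decay {T : ℝ → ℝ} (hT : IsPiecewiseC2Expanding T)
    (hTm : Measurable T) {μ : Measure ℝ} [IsProbabilityMeasure μ] {h : ℝ → ℝ} {c : ℝ}
    (hμ : HasBVDensity μ h c) (hmix : Mixing T μ) :
    ∃ τ > 0, ∀ (n : ℕ) (f ψ : ℝ → ℝ), BoundedVariationOn f (Icc 0 1) →
      ∫ x in Icc (0 : ℝ) 1, f x = 0 → Measurable ψ → (∀ x, |ψ x| ≤ 1) →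
        |∫ x in Icc (0 : ℝ) 1, f x * ψ (T^[n] x)| ≤
          2 * Real.exp (-τ * n) * realVariation f (Icc 0 1) := by
  obtain ⟨lam, Lam, hexp⟩ := hT
  obtain ⟨S, L, hS⟩ := hexp.exists_isExpandingOff
  have hmaps := hexp.2.2.1
  obtain ⟨N, hN⟩ := pow_unbounded_of_one_lt 8 hexp.1
  have hN0 : 0 < N := by
    rcases Nat.eq_zero_or_pos N with rfl | h0
    · norm_num at hN
    · exact h0
  obtain ⟨S', Lam', L', hS'⟩ := hS.iterate hmaps N
  obtain ⟨K, hK, P, hP⟩ := hS'.exists_transfer hN.le (hTm.iterate N) (hmaps.iterate N)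
  obtain ⟨n₁, hn₁, hdec⟩ := hP.exists_abs_integral_comp_le hK (hTm.iterate N) hμ
    (hmix.iterate hN0)
  have hM : 0 < N * n₁ := Nat.mul_pos hN0 hn₁
  refine ⟨Real.log 2 / (N * n₁ : ℕ), div_pos (Real.log_pos one_lt_two) (by exact_mod_cast hM),
    fun n f ψ hf hf0 hψ hψ1 => ?_⟩
  have := hdec (n / (N * n₁)) f (fun x => ψ (T^[n % (N * n₁)] x)) hf hf0
    (hψ.comp (hTm.iterate _)) fun x => hψ1 _
  have e : ∀ x, T^[n % (N * n₁)] ((T^[N])^[n₁ * (n / (N * n₁))] x) = T^[n] x := fun x => by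
    rw [← Function.iterate_mul, ← Function.iterate_add_apply, ← mul_assoc, Nat.mod_add_div]
  simp only [e] at this
  refine this.trans ?_
  rw [div_eq_mul_one_div, mul_comm]
  exact mul_le_mul_of_nonneg_right (inv_two_pow_div_le_exp hM n) (realVariation_nonneg _ _)

/-- Subintervals of `[0,1]` are mixed by `T` with respect to all measurable sets, at the exponential
rate `C e^{-τ n}`. -/
def MixesIntervals (T : ℝ → ℝ) (μ : Measure ℝ) (C τ : ℝ) : Prop :=
  ∀ (n : ℕ) (I A : Set ℝ), I.OrdConnected → MeasurableSet I → I ⊆ Icc 0 1 → MeasurableSet A →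
    |μ.real (I ∩ T^[n] ⁻¹' A) - μ.real I * μ.real A| ≤ C * Real.exp (-τ * n)

theorem IsPiecewiseC2Expanding.exists_mixesIntervals {T : ℝ → ℝ}
    (hT : IsPiecewiseC2Expanding T) {μ : Measure ℝ} [IsProbabilityMeasure μ]
    (hTμ : MeasurePreserving T μ μ) {h : ℝ → ℝ} {c : ℝ}
    (hμ : HasBVDensity μ h c) (hmix : Mixing T μ) :
    ∃ C > 0, ∃ τ > 0, MixesIntervals T μ C τ := by
  obtain ⟨τ, hτ, hdec⟩ := hT.exists_decay hTμ.measurable hμ hmix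
  have hc0 := zero_lt_one.trans_le hμ.one_le
  have hVh := realVariation_nonneg h (Icc (0 : ℝ) 1)
  refine ⟨2 * (2 * realVariation h (Icc 0 1) + 2 * c), by positivity, τ, hτ,
    fun n I A hI hIm hI1 hA => ?_⟩
  have hind := BoundedVariationOn.indicator hI hc0.le (hμ.bv.mono hI1) (fun x hx => by
    rw [abs_of_pos (hμ.pos (hI1 hx))]; exact (hμ.bounds x (hI1 hx)).2)
  have hind' := hind.1.mono (subset_univ (Icc (0 : ℝ) 1))
  have hindV := (hind.1.realVariation_mono (subset_univ (Icc (0 : ℝ) 1))).trans hind.2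
  have hf := hind'.sub_const_mul hμ.bv (μ.real I)
  have hIV := hμ.bv.realVariation_mono hI1
  have hμI : |μ.real I| ≤ 1 := by
    rw [abs_of_nonneg measureReal_nonneg]; exact measureReal_le_one
  have hV : realVariation (fun x => I.indicator h x - μ.real I * h x) (Icc 0 1) ≤
      2 * realVariation h (Icc 0 1) + 2 * c := by
    have := mul_le_mul_of_nonneg_right hμI hVh
    linarith [hf.2]
  have hint : ∀ B : Set ℝ, MeasurableSet B →
      ∫ x in Icc (0 : ℝ) 1, (I.indicator h x - μ.real I * h x) * B.indicator 1 x =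
        μ.real (I ∩ B) - μ.real I * μ.real B := fun B hB => by
    have e : ∀ x, (I.indicator h x - μ.real I * h x) * B.indicator (1 : ℝ → ℝ) x =
        h x * (I ∩ B).indicator 1 x - μ.real I * (h x * B.indicator 1 x) := fun x => by
      by_cases hx : x ∈ I <;> by_cases hx' : x ∈ B <;> simp [hx, hx']
    have hi : ∀ D : Set ℝ, MeasurableSet D →
        IntegrableOn (fun x => h x * D.indicator 1 x) (Icc 0 1) := fun D hD =>
      hμ.bv.integrableOn_mul measurableSet_Icc volume_Icc_zero_one_ne_top
        (measurable_one.indicator hD) (abs_indicator_one_le D)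
    simp only [e]
    rw [integral_sub (hi _ (hIm.inter hB)) ((hi _ hB).const_mul _), integral_const_mul,
      ← hμ.measureReal_eq_integral (hIm.inter hB), ← hμ.measureReal_eq_integral hB]
  have h0 : ∫ x in Icc (0 : ℝ) 1, (I.indicator h x - μ.real I * h x) = 0 := by
    simpa using hint univ MeasurableSet.univ
  have key := hdec n _ (A.indicator 1) hf.1 h0 (measurable_one.indicator hA)
    (abs_indicator_one_le A)
  have e : ∀ x, A.indicator (1 : ℝ → ℝ) (T^[n] x) = (T^[n] ⁻¹' A).indicator 1 x := fun x => by
    by_cases hx : T^[n] x ∈ A <;> simp [hx]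
  simp only [e] at key
  rw [hint _ (hTμ.measurable.iterate n hA),
    (hTμ.iterate n).measureReal_preimage hA.nullMeasurableSet] at key
  refine key.trans ?_
  rw [mul_right_comm]
  exact mul_le_mul_of_nonneg_right (mul_le_mul_of_nonneg_left hV zero_le_two) (Real.exp_pos _).le

namespace HasBVDensity

variable {μ : Measure ℝ} {h : ℝ → ℝ} {c : ℝ}

theorem measureReal_ball_le (hμ : HasBVDensity μ h c) (x : ℝ) {ρ : ℝ} (hρ : 0 ≤ ρ) :
    μ.real (Metric.ball x ρ ∩ Icc 0 1) ≤ 2 * c * ρ := by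
  have hc0 := zero_lt_one.trans_le hμ.one_le
  have h1 := hμ.measureReal_inter_eq_integral
    ((Metric.isOpen_ball (x := x) (ε := ρ)).measurableSet.inter measurableSet_Icc)
    inter_subset_right MeasurableSet.univ
  rw [inter_univ] at h1
  have hfin : volume (Metric.ball x ρ ∩ Icc 0 1) < ⊤ :=
    (measure_mono inter_subset_right).trans_lt volume_Icc_zero_one_ne_top.lt_top
  have h2 := norm_setIntegral_le_of_norm_le_const (μ := volume)
    (f := fun x => h x * (univ : Set ℝ).indicator 1 x) (C := c) hfin (fun y hy => by
      simpa [abs_of_pos (hμ.pos hy.2)] using (hμ.bounds y hy.2).2)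
  rw [h1]
  refine (le_abs_self _).trans (h2.trans ?_)
  have h3 : volume.real (Metric.ball x ρ ∩ Icc 0 1) ≤ 2 * ρ := by
    refine (measureReal_mono inter_subset_left measure_ball_lt_top.ne).trans_eq ?_
    exact Real.volume_real_ball hρ
  nlinarith

theorem le_measureReal_ball [IsProbabilityMeasure μ] (hμ : HasBVDensity μ h c) {x : ℝ}
    (hx : x ∈ Icc (0 : ℝ) 1) (ρ : ℝ) : c⁻¹ * min ρ 1 ≤ μ.real (Metric.ball x ρ) := by
  have hc0 := inv_pos.mpr (zero_lt_one.trans_le hμ.one_le)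
  rcases le_or_gt ρ 0 with hρ | hρ
  · exact (mul_nonpos_of_nonneg_of_nonpos hc0.le ((min_le_left _ _).trans hρ)).trans
      measureReal_nonneg
  have hm0 : 0 < min ρ 1 := lt_min hρ one_pos
  have hm1 : min ρ 1 ≤ 1 := min_le_right _ _
  have hmρ : min ρ 1 ≤ ρ := min_le_left _ _
  set m := min ρ 1
  have hJ1 : Ioo (x * (1 - m)) (x * (1 - m) + m) ⊆ Icc 0 1 := fun y hy => by
    constructor <;> nlinarith [hy.1, hy.2, hx.1, hx.2]
  have hJb : Ioo (x * (1 - m)) (x * (1 - m) + m) ⊆ Metric.ball x ρ := fun y hy => by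
    rw [Metric.mem_ball, Real.dist_eq, abs_lt]
    constructor <;> nlinarith [hy.1, hy.2, hx.1, hx.2]
  refine le_trans ?_ (measureReal_mono hJb (by finiteness))
  have h1 := hμ.measureReal_inter_eq_integral measurableSet_Ioo hJ1 MeasurableSet.univ
  simp only [inter_univ, indicator_univ, Pi.one_apply, mul_one] at h1
  rw [h1]
  have hhi := hμ.bv.integrableOn measurableSet_Icc volume_Icc_zero_one_ne_top
  have h2 := setIntegral_mono_on (integrableOn_const (C := c⁻¹) (by simp) (by simp))
    (hhi.mono_set hJ1) measurableSet_Ioo fun y hy => (hμ.bounds y (hJ1 hy)).1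
  rw [setIntegral_const, Real.volume_real_Ioo_of_le (by linarith), smul_eq_mul] at h2
  linarith

theorem sum_measureReal_grid_inter (hμ : HasBVDensity μ h c) {k : ℕ} (hk : 0 < k) {A : Set ℝ}
    (hA : MeasurableSet A) :
    ∑ j ∈ Finset.range k, μ.real (Ioo ((j : ℝ) / k) (((j + 1 : ℕ) : ℝ) / k) ∩ A) = μ.real A := by
  rw [hμ.measureReal_eq_integral hA, ← sum_grid_integral hk
    (hμ.bv.integrableOn_mul measurableSet_Icc volume_Icc_zero_one_ne_top
      (measurable_one.indicator hA) (abs_indicator_one_le A))]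
  exact Finset.sum_congr rfl fun j hj => hμ.measureReal_inter_eq_integral measurableSet_Ioo
    (Ioo_subset_Icc_self.trans (Icc_grid_subset hk (Finset.mem_range.mp hj))) hA

theorem sum_measureReal_grid [IsProbabilityMeasure μ] (hμ : HasBVDensity μ h c) {k : ℕ}
    (hk : 0 < k) :
    ∑ j ∈ Finset.range k, μ.real (Ioo ((j : ℝ) / k) (((j + 1 : ℕ) : ℝ) / k)) = 1 := by
  simpa using hμ.sum_measureReal_grid_inter hk MeasurableSet.univ

end HasBVDensity

theorem abs_sub_grid_lt {k : ℕ} {j : ℕ} {x : ℝ}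
    (hx : x ∈ Ioo ((j : ℝ) / k) (((j + 1 : ℕ) : ℝ) / k)) : |x - j / k| < 1 / k := by
  have := grid_sub k j
  rw [abs_lt]
  constructor <;> linarith [hx.1, hx.2]

theorem measurableSet_En {T : ℝ → ℝ} (hT : Measurable T) (r : ℕ → ℝ) (n : ℕ) :
    MeasurableSet (En T r n) :=
  measurableSet_Icc.inter
    (measurableSet_lt (((hT.iterate n).sub measurable_id).abs) measurable_const)

variable {T h : ℝ → ℝ} {μ : Measure ℝ} [IsProbabilityMeasure μ] {c C τ : ℝ}

theorem le_measureReal_En (hT : Measurable T) (hμ : HasBVDensity μ h c)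
    (hdec : MixesIntervals T μ C τ)
    (r : ℕ → ℝ) (n : ℕ) {k : ℕ} (hk : 0 < k) :
    c⁻¹ * (min (r n) 1 - 1 / k) - k * (C * Real.exp (-τ * n)) ≤ μ.real (En T r n) := by
  have hc0 := inv_pos.mpr (zero_lt_one.trans_le hμ.one_le)
  have hk0 : (0 : ℝ) < 1 / k := one_div_pos.mpr (by exact_mod_cast hk)
  have hmin : min (r n) 1 - 1 / k ≤ min (r n - 1 / k) 1 :=
    le_min (by linarith [min_le_left (r n) 1]) (by linarith [min_le_right (r n) 1])
  rw [← hμ.sum_measureReal_grid_inter hk (measurableSet_En hT r n)]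
  have hj : ∀ j ∈ Finset.range k,
      μ.real (Ioo ((j : ℝ) / k) (((j + 1 : ℕ) : ℝ) / k)) * (c⁻¹ * (min (r n) 1 - 1 / k)) -
        C * Real.exp (-τ * n) ≤
      μ.real (Ioo ((j : ℝ) / k) (((j + 1 : ℕ) : ℝ) / k) ∩ En T r n) := fun j hj => by
    have hsub := Icc_grid_subset hk (Finset.mem_range.mp hj)
    have hsub' := Ioo_subset_Icc_self.trans hsub
    have hmem := hsub (left_mem_Icc.mpr (grid_monotone k j.le_succ))
    have h1 := (abs_le.mp (hdec n _ _ ordConnected_Ioo measurableSet_Ioo hsub'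
      (Metric.isOpen_ball (x := (j : ℝ) / k) (ε := r n - 1 / k)).measurableSet)).1
    have h2 := (mul_le_mul_of_nonneg_left hmin hc0.le).trans
      (hμ.le_measureReal_ball hmem (r n - 1 / k))
    have h3 := mul_le_mul_of_nonneg_left h2
      (measureReal_nonneg (μ := μ) (s := Ioo ((j : ℝ) / k) (((j + 1 : ℕ) : ℝ) / k)))
    have hincl : Ioo ((j : ℝ) / k) (((j + 1 : ℕ) : ℝ) / k) ∩
        T^[n] ⁻¹' Metric.ball ((j : ℝ) / k) (r n - 1 / k) ⊆
        Ioo ((j : ℝ) / k) (((j + 1 : ℕ) : ℝ) / k) ∩ En T r n := by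
      rintro x ⟨hxJ, hx⟩
      refine ⟨hxJ, hsub' hxJ, ?_⟩
      rw [mem_preimage, Metric.mem_ball, Real.dist_eq] at hx
      have h4 := abs_sub_le (T^[n] x) (j / k) x
      have h5 := abs_sub_grid_lt hxJ
      rw [abs_sub_comm] at h5
      linarith
    have h6 := measureReal_mono (μ := μ) hincl (by finiteness)
    linarith
  have := Finset.sum_le_sum hj
  rw [Finset.sum_sub_distrib, ← Finset.sum_mul, hμ.sum_measureReal_grid hk, Finset.sum_const,
    Finset.card_range, nsmul_eq_mul, one_mul] at this
  exact this

theorem measureReal_En_inter_le (hT : Measurable T) (hmaps : MapsTo T (Icc 0 1) (Icc 0 1))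
    (hμ : HasBVDensity μ h c)
    (hdec : MixesIntervals T μ C τ)
    {r : ℕ → ℝ} (hr : ∀ n, 0 ≤ r n) (m n : ℕ) {k : ℕ} (hk : 0 < k) :
    μ.real (En T r n ∩ En T r (n + m)) ≤
      min 1 (2 * c * (r n + 1 / k)) * min 1 (2 * c * (r (n + m) + 1 / k)) +
        C * Real.exp (-τ * m) + k * (C * Real.exp (-τ * n)) := by
  have hk0 : (0 : ℝ) < 1 / k := one_div_pos.mpr (by exact_mod_cast hk)
  rw [← hμ.sum_measureReal_grid_inter hk
    ((measurableSet_En hT r n).inter (measurableSet_En hT r (n + m)))]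
  set D := min 1 (2 * c * (r n + 1 / k)) * min 1 (2 * c * (r (n + m) + 1 / k)) +
    C * Real.exp (-τ * m)
  have hball : ∀ (x ρ : ℝ), 0 ≤ ρ → μ.real (Metric.ball x ρ ∩ Icc 0 1) ≤ min 1 (2 * c * ρ) :=
    fun x ρ hρ => le_min measureReal_le_one (hμ.measureReal_ball_le x hρ)
  have hj : ∀ j ∈ Finset.range k,
      μ.real (Ioo ((j : ℝ) / k) (((j + 1 : ℕ) : ℝ) / k) ∩ (En T r n ∩ En T r (n + m))) ≤
      μ.real (Ioo ((j : ℝ) / k) (((j + 1 : ℕ) : ℝ) / k)) * D + C * Real.exp (-τ * n) :=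
      fun j hj => by
    have hsub' := Ioo_subset_Icc_self.trans (Icc_grid_subset hk (Finset.mem_range.mp hj))
    set J := Ioo ((j : ℝ) / k) (((j + 1 : ℕ) : ℝ) / k) with hJ
    have hBm : ∀ ρ, MeasurableSet (Metric.ball ((j : ℝ) / k) ρ ∩ Icc 0 1) := fun ρ =>
      Metric.isOpen_ball.measurableSet.inter measurableSet_Icc
    have hBo : ∀ ρ, (Metric.ball ((j : ℝ) / k) ρ ∩ Icc 0 1).OrdConnected := fun ρ => by
      rw [Real.ball_eq_Ioo]
      exact ordConnected_Ioo.inter ordConnected_Icc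
    have hmem : ∀ i, ∀ x ∈ J ∩ En T r i,
        T^[i] x ∈ Metric.ball ((j : ℝ) / k) (r i + 1 / k) ∩ Icc 0 1 := by
      rintro i x ⟨hxJ, hx1, hx⟩
      refine ⟨?_, hmaps.iterate i hx1⟩
      rw [Metric.mem_ball, Real.dist_eq]
      exact (abs_sub_le _ x _).trans_lt (add_lt_add hx (abs_sub_grid_lt hxJ))
    set B := Metric.ball ((j : ℝ) / k) (r n + 1 / k) ∩ Icc 0 1
    set B' := Metric.ball ((j : ℝ) / k) (r (n + m) + 1 / k) ∩ Icc 0 1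
    have hincl : J ∩ (En T r n ∩ En T r (n + m)) ⊆ J ∩ T^[n] ⁻¹' (B ∩ T^[m] ⁻¹' B') := by
      rintro x ⟨hxJ, hxn, hxm⟩
      refine ⟨hxJ, hmem n x ⟨hxJ, hxn⟩, ?_⟩
      have := hmem (n + m) x ⟨hxJ, hxm⟩
      rwa [add_comm n m, Function.iterate_add_apply, add_comm m n] at this
    have h1 := (abs_le.mp (hdec n J (B ∩ T^[m] ⁻¹' B') ordConnected_Ioo measurableSet_Ioo hsub'
      ((hBm _).inter (hT.iterate m (hBm _))))).2
    have h2 := (abs_le.mp (hdec m B B' (hBo _) (hBm _) inter_subset_right (hBm _))).2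
    have h3 : μ.real B * μ.real B' ≤
        min 1 (2 * c * (r n + 1 / k)) * min 1 (2 * c * (r (n + m) + 1 / k)) :=
      mul_le_mul (hball _ _ (add_nonneg (hr _) hk0.le)) (hball _ _ (add_nonneg (hr _) hk0.le))
        measureReal_nonneg (measureReal_nonneg.trans (hball 0 _ (add_nonneg (hr _) hk0.le)))
    have h4 : μ.real (B ∩ T^[m] ⁻¹' B') ≤ D := by linarith
    have h5 := mul_le_mul_of_nonneg_left h4 (measureReal_nonneg (μ := μ) (s := J))
    have h6 := measureReal_mono (μ := μ) hincl (by finiteness)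
    linarith
  have := Finset.sum_le_sum hj
  rw [Finset.sum_add_distrib, ← Finset.sum_mul, hμ.sum_measureReal_grid hk, Finset.sum_const,
    Finset.card_range, nsmul_eq_mul, one_mul] at this
  exact this

end DecayOfCorrelations

theorem stmt12 (T : ℝ → ℝ) (hT : IsPiecewiseC2Expanding T)
    (μ : Measure ℝ) [IsProbabilityMeasure μ] (hmix : Mixing T μ) (hErg : Ergodic T μ)
    (h : ℝ → ℝ) (c : ℝ) (hc : 1 ≤ c)
    (hdens : μ = (volume.restrict (Set.Icc 0 1)).withDensity (fun x => ENNReal.ofReal (h x)))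
    (hBV : BoundedVariationOn h (Set.Icc 0 1))
    (hbound : ∀ x ∈ Set.Icc (0:ℝ) 1, c⁻¹ ≤ h x ∧ h x ≤ c)
    (r : ℕ → ℝ) (hr : ∀ n, 0 ≤ r n)
    (H : ℝ) (hH : H = 4 * c ^ 4) :
    ∃ C > (0:ℝ), ∃ τ > (0:ℝ), ∀ m n : ℕ,
      (μ (En T r n ∩ En T r (n + m))).toReal ≤
        H * (μ (En T r n)).toReal * (μ (En T r (n + m))).toReal +
          C * (Real.exp (-τ * n) + Real.exp (-τ * m)) := by
  have hμ : HasBVDensity μ h c := ⟨hc, hdens, hBV, hbound⟩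
  have hTm := hErg.toMeasurePreserving.measurable
  have hc0 : 0 < c := zero_lt_one.trans_le hc
  obtain ⟨C, hC, τ, hτ, hdec⟩ := hT.exists_mixesIntervals hErg.toMeasurePreserving hμ hmix
  have hmaps : Set.MapsTo T (Set.Icc 0 1) (Set.Icc 0 1) := by
    obtain ⟨_, _, hexp⟩ := hT
    exact hexp.2.2.1
  refine ⟨(2 * c ^ 2 + 1) * (4 * c + 4 * c ^ 2 * C) + 3 * C, by positivity, τ / 2,
    half_pos hτ, fun m n => ?_⟩
  change μ.real _ ≤ H * μ.real _ * μ.real _ + _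
  set η := Real.exp (-(τ / 2) * n) with hη
  have hη0 : 0 < η := Real.exp_pos _
  have hη1 : η ≤ 1 := Real.exp_le_one_iff.mpr (by
    have := mul_nonneg (half_pos hτ).le (Nat.cast_nonneg (α := ℝ) n); linarith)
  have hηsq : Real.exp (-τ * n) = η * η := by
    rw [hη, ← Real.exp_add]; congr 1; ring
  obtain ⟨k, hk0, hk1, hk2⟩ : ∃ k : ℕ, 0 < k ∧ 1 / (k : ℝ) ≤ η ∧ k * (η * η) ≤ 2 * η := by
    have h1 : 0 < η⁻¹ := inv_pos.mpr hη0
    refine ⟨⌈η⁻¹⌉₊, Nat.ceil_pos.mpr h1, ?_, ?_⟩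
    · rw [one_div]
      exact inv_le_of_inv_le₀ hη0 (Nat.le_ceil _)
    · have h2 := (Nat.ceil_lt_add_one h1.le).le
      have h3 := mul_le_mul_of_nonneg_right h2 (mul_pos hη0 hη0).le
      have h4 : (η⁻¹ + 1) * (η * η) = η + η * η := by field_simp
      nlinarith
  set δ := 1 / (k : ℝ)
  have hδ0 : 0 < δ := one_div_pos.mpr (by exact_mod_cast hk0)
  have hkC : k * (C * Real.exp (-τ * n)) ≤ 2 * C * η := by
    rw [hηsq]; nlinarith
  have hm : C * Real.exp (-τ * m) ≤ C * Real.exp (-(τ / 2) * m) := by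
    refine mul_le_mul_of_nonneg_left (Real.exp_le_exp.mpr ?_) hC.le
    have := mul_nonneg (half_pos hτ).le (Nat.cast_nonneg (α := ℝ) m)
    linarith
  have hlow : ∀ i, n ≤ i → min 1 (2 * c * (r i + δ)) ≤
      2 * c ^ 2 * μ.real (En T r i) + (4 * c + 4 * c ^ 2 * C) * η := fun i hi => by
    have h1 := le_measureReal_En hTm hμ hdec r i hk0
    have h2 : k * (C * Real.exp (-τ * i)) ≤ 2 * C * η := by
      refine le_trans ?_ hkC
      have : Real.exp (-τ * i) ≤ Real.exp (-τ * n) := by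
        have hi' : (n : ℝ) ≤ i := by exact_mod_cast hi
        exact Real.exp_le_exp.mpr (by nlinarith)
      gcongr
    have h3 : min (r i) 1 ≤ c * μ.real (En T r i) + δ + c * (2 * C * η) := by
      have h4 := mul_le_mul_of_nonneg_left (h1.trans' (sub_le_sub_left h2 _)) hc0.le
      rw [mul_sub, mul_inv_cancel_left₀ hc0.ne'] at h4
      linarith
    have h5 : min 1 (2 * c * (r i + δ)) ≤ 2 * c * min (r i) 1 + 2 * c * δ := by
      rcases le_total (r i) 1 with h6 | h6
      · rw [min_eq_left h6]
        exact (min_le_right _ _).trans_eq (by ring)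
      · rw [min_eq_right h6]
        exact (min_le_left _ _).trans (by nlinarith)
    nlinarith
  have hup := measureReal_En_inter_le hTm hmaps hμ hdec hr m n hk0
  have hp := hlow n le_rfl
  have hq := hlow (n + m) (Nat.le_add_right n m)
  have hq0 : 0 ≤ min 1 (2 * c * (r (n + m) + δ)) :=
    le_min zero_le_one (mul_nonneg (by positivity) (add_nonneg (hr _) hδ0.le))
  have hq1 : min 1 (2 * c * (r (n + m) + δ)) ≤ 1 := min_le_left _ _
  have hx1 : μ.real (En T r n) ≤ 1 := measureReal_le_one
  have hx0 : 0 ≤ μ.real (En T r n) := measureReal_nonneg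
  set p := min 1 (2 * c * (r n + δ))
  set q := min 1 (2 * c * (r (n + m) + δ))
  set x := μ.real (En T r n)
  set y := μ.real (En T r (n + m))
  set e := 4 * c + 4 * c ^ 2 * C
  have he : 0 ≤ e * η := by positivity
  have hpq : p * q ≤ 4 * c ^ 4 * x * y + (2 * c ^ 2 + 1) * e * η := by
    calc p * q ≤ (2 * c ^ 2 * x + e * η) * q := mul_le_mul_of_nonneg_right hp hq0
      _ = 2 * c ^ 2 * x * q + e * η * q := by ring
      _ ≤ 2 * c ^ 2 * x * (2 * c ^ 2 * y + e * η) + e * η * 1 := by gcongr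
      _ = 4 * c ^ 4 * x * y + (2 * c ^ 2) * (e * η) * x + e * η := by ring
      _ ≤ 4 * c ^ 4 * x * y + (2 * c ^ 2) * (e * η) * 1 + e * η := by gcongr
      _ = _ := by ring
  have hm0 := Real.exp_pos (-(τ / 2) * m)
  have he0 : 0 ≤ (2 * c ^ 2 + 1) * e := by positivity
  rw [hH]
  nlinarith [mul_nonneg he0 hm0.le, mul_pos hC hm0, mul_pos hC hη0]
end
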